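/- arXiv:2405.17593 — 3 statements merged into one kernel-verified Lean document; each statement's English description precedes it below -/
import Mathlib

section
/- Let H be a finite group, G a group, and γ : H → G a surjective homomorphism with kernel N, such that for every proper subgroup K < H the image of K under γ is a proper subgroup of G. Then N is nilpotent. -/
/-- If `γ : H → G` is a surjective homomorphism from a finite group `H`
such that every proper subgroup of `H` has proper image in `G`, then `ker γ` is
nilpotent. -/
theorem stmt_1 {H G : Type*} [Group H] [Finite H] [Group G]
    (γ : H →* G) (hsurj : Function.Surjective γ)
    (hmin : ∀ K : Subgroup H, K < ⊤ → Subgroup.map γ K < ⊤) :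
    Group.IsNilpotent γ.ker := by
  have nilpotent_iff := (Group.isNilpotent_of_finite_tfae (G := γ.ker)).out 0 3
  rw [nilpotent_iff]
  intro p _ P
  have frattini_argument := Sylow.normalizer_sup_eq_top P
  set K : Subgroup H := Subgroup.normalizer (P.map γ.ker.subtype)
  have map_eq_top : K.map γ = ⊤ := by
    rw [← Subgroup.map_top_of_surjective γ hsurj, ← frattini_argument, Subgroup.map_sup,
      (Subgroup.map_eq_bot_iff γ.ker).mpr le_rfl, sup_bot_eq]
  have eq_top : K = ⊤ := by
    by_contra h
    exact (hmin K (lt_top_iff_ne_top.mpr h)).ne map_eq_top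
  have normal : (P.map γ.ker.subtype).Normal := Subgroup.normalizer_eq_top_iff.mp eq_top
  exact Subgroup.Normal.of_map_subtype normal
end

section
/- Let R be an extraspecial r-group of order r^{1+2n} for an odd prime r and exponent r. Then the short exact sequence 1 → Inn(R) → C_{Aut(R)}(Z(R)) → Sp_{2n}(r) → 1 splits, where the quotient map is induced by the action of automorphisms centralizing Z(R) on R/Z(R) preserving the commutator form. -/
/-- An extraspecial `p`-group. -/
def IsExtraspecial (p : ℕ) (R : Type*) [Group R] : Prop :=
  IsPGroup p R ∧ Nat.card (Subgroup.center R) = p ∧ Subgroup.center R = commutator R ∧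
    ∀ x : R ⧸ Subgroup.center R, x ^ p = 1

/-- The subgroup of `Aut(R)` consisting of automorphisms fixing the center pointwise. -/
def centralAut (R : Type*) [Group R] : Subgroup (MulAut R) where
  carrier := {φ | ∀ z ∈ Subgroup.center R, φ z = z}
  one_mem' := fun _ _ => rfl
  mul_mem' := by
    intro a b ha hb z hz
    show a (b z) = z
    rw [hb z hz, ha z hz]
  inv_mem' := by
    intro a ha z hz
    show a⁻¹ z = z
    exact a.injective (by rw [MulAut.apply_inv_self R a z, ha z hz])

open Matrix in
/-- A family whose Gram matrix is the standard symplectic matrix can be paired against the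
coefficients of a linear combination. -/
theorem apply_sum_smul_of_gram_eq_J {F M l : Type*} [Field F] [AddCommGroup M] [Module F M]
    [Fintype l] [DecidableEq l] (B : LinearMap.BilinForm F M) {b : l ⊕ l → M}
    (hb : ∀ i j, B (b i) (b j) = J l F i j) (v : l ⊕ l → F) (i : l ⊕ l) :
    B (b i) (∑ j, v j • b j) = (J l F *ᵥ v) i := by
  simp [map_sum, hb, mulVec, dotProduct, mul_comm]

open Matrix in
/-- The component of `y` orthogonal to a symplectic family. -/
theorem exists_sub_sum_smul_orthogonal {F M l : Type*} [Field F] [AddCommGroup M] [Module F M]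
    [Fintype l] [DecidableEq l] (B : LinearMap.BilinForm F M) {b : l ⊕ l → M}
    (hb : ∀ i j, B (b i) (b j) = J l F i j) (y : M) :
    ∃ v : l ⊕ l → F, ∀ i, B (b i) (y - ∑ j, v j • b j) = 0 := by
  refine ⟨-(J l F *ᵥ fun i => B (b i) y), fun i => ?_⟩
  rw [map_sub, apply_sum_smul_of_gram_eq_J B hb, mulVec_neg, mulVec_mulVec, J_squared, neg_mulVec,
    one_mulVec]
  simp

open Matrix in
/-- Existence of a symplectic family of size `2m` for every `m ≤ n` in a space of order
`|F| ^ (1 + 2n)` carrying an alternating form with one-dimensional radical. -/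
theorem exists_symplectic_family {F M : Type*} [Field F] [Finite F] [AddCommGroup M] [Module F M]
    (B : LinearMap.BilinForm F M) (hB : B.IsAlt) (k : F →ₗ[F] M)
    (hrad : ∀ x, (∀ y, B x y = 0) → ∃ a, k a = x)
    {n : ℕ} (hcard : Nat.card M = Nat.card F ^ (1 + 2 * n)) {m : ℕ} (hm : m ≤ n) :
    ∃ b : Fin m ⊕ Fin m → M, ∀ i j, B (b i) (b j) = J (Fin m) F i j := by
  induction m with
  | zero => exact ⟨Sum.elim Fin.elim0 Fin.elim0, fun i => by rcases i with i | i <;> exact i.elim0⟩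
  | succ m ih =>
    obtain ⟨b, hb⟩ := ih (by omega)
    obtain ⟨x, hx, hxr⟩ : ∃ x, (∀ i, B (b i) x = 0) ∧ ¬ ∀ y, B x y = 0 := by
      by_contra! h
      have hs : Function.Surjective
          (fun p : (Fin m ⊕ Fin m → F) × F => ∑ j, p.1 j • b j + k p.2) := by
        intro y
        obtain ⟨v, hv⟩ := exists_sub_sum_smul_orthogonal B hb y
        obtain ⟨a, ha⟩ := hrad _ (h _ hv)
        exact ⟨(v, a), by simp [ha]⟩
      have hle := Nat.card_le_card_of_surjective _ hs
      rw [hcard, Nat.card_prod, Nat.card_fun, Nat.card_sum, Nat.card_fin, ← pow_succ] at hle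
      have := (Nat.pow_le_pow_iff_right Finite.one_lt_card).1 hle
      omega
    obtain ⟨y, hy⟩ := not_forall.1 hxr
    obtain ⟨v, hv⟩ := exists_sub_sum_smul_orthogonal B hb y
    set w := (B x y)⁻¹ • (y - ∑ j, v j • b j) with hw
    have hx' : ∀ i, B x (b i) = 0 := fun i => hB.eq_iff.1 (hx i)
    have hxw : B x w = 1 := by
      simp [hw, map_sum, hx', hy]
    have hwx : B w x = -1 := by rw [← LinearMap.IsAlt.neg hB, hxw]
    have hbw : ∀ i, B (b i) w = 0 := fun i => by rw [hw, map_smul, hv, smul_zero]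
    have hwb : ∀ i, B w (b i) = 0 := fun i => hB.eq_iff.1 (hbw i)
    refine ⟨Sum.elim (Fin.cons w (b ∘ Sum.inl)) (Fin.cons x (b ∘ Sum.inr)), ?_⟩
    rintro (i | i) (j | j) <;> refine Fin.cases ?_ (fun i => ?_) i <;>
      refine Fin.cases ?_ (fun j => ?_) j <;>
      simp [J, hB.self_eq_zero, hx, hx', hwb, hbw, hwx, hxw, hb, Matrix.one_apply, Fin.succ_ne_zero,
        (Fin.succ_ne_zero _).symm]

open Matrix in
/-- Coordinates adapted to an alternating form with one-dimensional radical. -/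
theorem exists_symplectic_coords {F M : Type*} [Field F] [Finite F] [AddCommGroup M] [Module F M]
    (B : LinearMap.BilinForm F M) (hB : B.IsAlt) (k : F →ₗ[F] M) (hk : Function.Injective k)
    (hrad : ∀ x, (∀ y, B x y = 0) → ∃ a, k a = x) (hkB : ∀ x a, B x (k a) = 0)
    {n : ℕ} (hcard : Nat.card M = Nat.card F ^ (1 + 2 * n)) :
    ∃ L : M ≃ₗ[F] (Fin n ⊕ Fin n → F) × F, (∀ a, L (k a) = (0, a)) ∧
      ∀ x y, B x y = (L x).1 ⬝ᵥ J (Fin n) F *ᵥ (L y).1 := by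
  obtain ⟨b, hb⟩ := exists_symplectic_family B hB k hrad hcard le_rfl
  let T : ((Fin n ⊕ Fin n → F) × F) →ₗ[F] M := (Fintype.linearCombination F b).coprod k
  have hT : ∀ v a, T (v, a) = ∑ j, v j • b j + k a := fun v a => by
    simp [T, Fintype.linearCombination_apply]
  have hBT : ∀ v a i, B (b i) (T (v, a)) = (J (Fin n) F *ᵥ v) i := fun v a i => by
    rw [hT, map_add, hkB, add_zero, apply_sum_smul_of_gram_eq_J B hb]
  have hinj : Function.Injective T := by
    refine (injective_iff_map_eq_zero T).2 ?_
    rintro ⟨v, a⟩ h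
    have hJ : J (Fin n) F *ᵥ v = 0 := funext fun i => by rw [← hBT v a, h, map_zero]; rfl
    have hv : v = 0 := by
      have := congrArg (J (Fin n) F *ᵥ ·) hJ
      simpa [mulVec_mulVec, J_squared, neg_mulVec] using this
    subst hv
    rw [hT] at h
    have ha : k a = k 0 := by simpa using h
    rw [hk ha]; rfl
  have hbij : Function.Bijective T := by
    have : Finite M := Nat.finite_of_card_ne_zero <| by
      rw [hcard]; exact pow_ne_zero _ Nat.card_pos.ne'
    refine (Nat.bijective_iff_injective_and_card T).2 ⟨hinj, ?_⟩
    rw [hcard, Nat.card_prod, Nat.card_fun, Nat.card_sum, Nat.card_fin, ← pow_succ]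
    congr 1; omega
  let E := LinearEquiv.ofBijective T hbij
  have hE : ∀ p, E p = T p := fun _ => rfl
  refine ⟨E.symm, fun a => ?_, fun x y => ?_⟩
  · rw [LinearEquiv.symm_apply_eq, hE, hT]; simp
  · obtain ⟨⟨v, a⟩, rfl⟩ := E.surjective x
    obtain ⟨⟨w, c⟩, rfl⟩ := E.surjective y
    have hkB' : ∀ x a, B (k a) x = 0 := fun x a => hB.eq_iff.1 (hkB x a)
    simp only [LinearEquiv.symm_apply_apply]
    rw [hE, hE, hT v, map_add, LinearMap.add_apply, hkB', add_zero, map_sum, LinearMap.sum_apply]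
    simp [hBT, dotProduct]

/-- Baer's trick: a group of class two whose commutators are values of `k` at `c` carries an
abelian group structure with sum `x * y * k (-c x y / 2)`. -/
theorem exists_baer_addCommGroup {R F : Type*} [Group R] [Field F] (h2 : (2 : F) ≠ 0)
    (k : Multiplicative F →* R) (hkc : ∀ a x, x * k a = k a * x) (c : R → R → F)
    (hc : ∀ x y, x * y = y * x * k (.ofAdd (c x y)))
    (hcl : ∀ x y w, c (x * y) w = c x w + c y w) (hcr : ∀ x y w, c w (x * y) = c w x + c w y)
    (hcs : ∀ x, c x x = 0) (hckl : ∀ a x, c (k a) x = 0) (hckr : ∀ a x, c x (k a) = 0) :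
    ∃ _ : AddCommGroup R, (∀ x y : R, x + y = x * y * k (.ofAdd (-(2⁻¹ * c x y)))) ∧
      (∀ (m : ℕ) (x : R), m • x = x ^ m) ∧ (0 : R) = 1 := by
  have hcl1 : ∀ x, c 1 x = 0 := fun x => by simpa using hcl 1 1 x
  have hcr1 : ∀ x, c x 1 = 0 := fun x => by simpa using hcr 1 1 x
  have hanti : ∀ x y, c y x = -c x y := fun x y => by
    have := hcs (x * y)
    rw [hcl, hcr, hcr, hcs, hcs] at this
    linear_combination this
  have hinv : ∀ x, c x⁻¹ x = 0 := fun x => by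
    have := hcl x⁻¹ x x
    rw [inv_mul_cancel, hcl1, hcs] at this
    linear_combination -this
  have hpow : ∀ (m : ℕ) x, c (x ^ m) x = 0 := fun m x => by
    induction m with
    | zero => simpa using hcl1 x
    | succ m ih => rw [pow_succ, hcl, ih, hcs, add_zero]
  have hk : ∀ a b : F, k (.ofAdd a) * k (.ofAdd b) = k (.ofAdd (a + b)) := fun a b =>
    (k.map_mul _ _).symm
  let add : R → R → R := fun x y => x * y * k (.ofAdd (-(2⁻¹ * c x y)))
  let _ : AddCommGroup R :=
    { add := add
      zero := 1
      neg := fun x => x⁻¹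
      add_assoc := fun x y w => by
        change add (add x y) w = add x (add y w)
        simp only [add, hcl, hcr, hckl, hckr]
        rw [mul_assoc (x * y), ← hkc, ← mul_assoc, mul_assoc _ (k _) (k _), hk, ← mul_assoc,
          ← mul_assoc, mul_assoc _ (k _) (k _), hk]
        congr 3
        ring
      zero_add := fun x => by
        change add 1 x = x
        simp [add, hcl1]
      add_zero := fun x => by
        change add x 1 = x
        simp [add, hcr1]
      neg_add_cancel := fun x => by
        change add x⁻¹ x = 1
        simp [add, hinv]
      add_comm := fun x y => by
        change add x y = add y x
        simp only [add]
        rw [hc x y, mul_assoc, hk, hanti x y]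
        congr 3
        field_simp
        ring
      nsmul := @nsmulRec R ⟨1⟩ ⟨add⟩
      zsmul := @zsmulRec R ⟨1⟩ ⟨add⟩ ⟨fun x => x⁻¹⟩ (@nsmulRec R ⟨1⟩ ⟨add⟩) }
  refine ⟨inferInstance, fun _ _ => rfl, fun m x => ?_, rfl⟩
  induction m with
  | zero => exact (pow_zero x).symm
  | succ m ih =>
    rw [succ_nsmul, ih]
    change add (x ^ m) x = x ^ (m + 1)
    simp [add, hpow, pow_succ]

theorem ZMod.two_ne_zero_of_prime_of_ne_two {r : ℕ} (hr : r.Prime) (hodd : r ≠ 2) :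
    (2 : ZMod r) ≠ 0 := by
  intro h
  have h' : ((2 : ℕ) : ZMod r) = 0 := by exact_mod_cast h
  rw [ZMod.natCast_eq_zero_iff] at h'
  exact hodd ((Nat.prime_dvd_prime_iff_eq hr Nat.prime_two).1 h')

open Matrix in
/-- The bijection `e` carries the multiplication of `R` to that of the standard Heisenberg group. -/
def IsHeisenbergChart {R F l : Type*} [Group R] [Field F] [Fintype l] [DecidableEq l]
    (e : R ≃ (l ⊕ l → F) × F) : Prop :=
  ∀ x y, e (x * y) =
    ((e x).1 + (e y).1, (e x).2 + (e y).2 + 2⁻¹ * ((e x).1 ⬝ᵥ J l F *ᵥ (e y).1))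

open Matrix commutatorElement in
/-- Heisenberg coordinates on an extraspecial group of odd exponent `r`. -/
theorem IsExtraspecial.exists_heisenberg_coords {r n : ℕ} [Fact r.Prime] (h2 : (2 : ZMod r) ≠ 0)
    {R : Type*} [Group R] (hext : IsExtraspecial r R) (hcard : Nat.card R = r ^ (1 + 2 * n))
    (hexp : ∀ x : R, x ^ r = 1) :
    ∃ e : R ≃ (Fin n ⊕ Fin n → ZMod r) × ZMod r, IsHeisenbergChart e := by
  obtain ⟨-, hZ, hZcomm, -⟩ := hext
  let ζ : Multiplicative (ZMod r) ≃* Subgroup.center R :=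
    mulEquivOfPrimeCardEq (p := r) (by simp) hZ
  let k : Multiplicative (ZMod r) →* R := (Subgroup.center R).subtype.comp ζ.toMonoidHom
  have hkinj : Function.Injective k := Subtype.val_injective.comp ζ.injective
  have hkc : ∀ a x, x * k a = k a * x := fun a x => Subgroup.mem_center_iff.1 (ζ a).2 x
  have hksurj : ∀ x ∈ Subgroup.center R, ∃ a : ZMod r, k (.ofAdd a) = x := fun x hx =>
    ⟨(ζ.symm ⟨x, hx⟩).toAdd, by simp [k]⟩
  have hk : ∀ a b : ZMod r, k (.ofAdd a) * k (.ofAdd b) = k (.ofAdd (a + b)) := fun a b =>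
    (k.map_mul _ _).symm
  have hkinj' : ∀ a b : ZMod r, k (.ofAdd a) = k (.ofAdd b) → a = b := fun a b h => hkinj h
  have hex : ∀ x y : R, ∃ a : ZMod r, x * y = y * x * k (.ofAdd a) := fun x y => by
    have hmem : ⁅x, y⁆ ∈ Subgroup.center R := by
      rw [hZcomm]
      exact Subgroup.commutator_mem_commutator (Subgroup.mem_top x) (Subgroup.mem_top y)
    obtain ⟨a, ha⟩ := hksurj _ hmem
    refine ⟨a, ?_⟩
    rw [hkc, ha, commutatorElement_def]
    group
  choose c hc using hex
  have hcuniq : ∀ x y a, x * y = y * x * k (.ofAdd a) → c x y = a := fun x y a h =>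
    hkinj' _ _ (mul_left_cancel ((hc x y).symm.trans h))
  have hcl : ∀ x y w, c (x * y) w = c x w + c y w := fun x y w => by
    apply hcuniq
    rw [mul_assoc, hc y w, ← mul_assoc, ← mul_assoc, hc x w, mul_assoc _ (k _) y, ← hkc,
      ← mul_assoc, mul_assoc _ (k _) (k _), hk, mul_assoc w]
  have hcr : ∀ x y w, c w (x * y) = c w x + c w y := fun x y w => by
    apply hcuniq
    rw [← mul_assoc, hc w x, mul_assoc _ (k _) y, ← hkc, ← mul_assoc, mul_assoc x w y, hc w y,
      ← mul_assoc, ← mul_assoc, mul_assoc _ (k _) (k _), hk, add_comm]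
  have hcs : ∀ x, c x x = 0 := fun x => hcuniq _ _ _ (by simp)
  have hckl : ∀ a x, c (k a) x = 0 := fun a x => hcuniq _ _ _ (by simp [hkc])
  have hckr : ∀ a x, c x (k a) = 0 := fun a x => hcuniq _ _ _ (by simp [hkc])
  obtain ⟨_, hadd, hsmul, hzero⟩ := exists_baer_addCommGroup h2 k hkc c hc hcl hcr hcs hckl hckr
  have : Module (ZMod r) R := AddCommGroup.zmodModule fun x => by rw [hsmul, hexp, hzero]
  have hcl' : ∀ x y w, c (x + y) w = c x w + c y w := fun x y w => by
    rw [hadd, hcl, hcl, hckl, add_zero]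
  have hcr' : ∀ w x y, c w (x + y) = c w x + c w y := fun w x y => by
    rw [hadd, hcr, hcr, hckr, add_zero]
  let B : LinearMap.BilinForm (ZMod r) R := LinearMap.mk₂ (ZMod r) c hcl'
    (fun a x w => ZMod.map_smul (AddMonoidHom.mk' (c · w) fun x y => hcl' x y w) a x) hcr'
    (fun a w x => ZMod.map_smul (AddMonoidHom.mk' (c w) (hcr' w)) a x)
  have hBc : ∀ x y, B x y = c x y := fun _ _ => rfl
  let κ : ZMod r →ₗ[ZMod r] R := AddMonoidHom.toZModLinearMap r (AddMonoidHom.mk'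
    (fun a => k (.ofAdd a)) fun a b => by simp [hadd, hckl])
  have hκ : ∀ a, κ a = k (.ofAdd a) := fun _ => rfl
  have hrad : ∀ x, (∀ y, B x y = 0) → ∃ a, κ a = x := fun x hx => by
    refine hksurj x (Subgroup.mem_center_iff.2 fun y => ?_)
    have h := hc x y
    rw [show c x y = 0 from hx y] at h
    simpa using h.symm
  obtain ⟨L, hL, hLB⟩ := exists_symplectic_coords B hcs κ hkinj' hrad (fun x a => hckr _ x)
    (n := n) (by rw [hcard, Nat.card_zmod])
  have hmk : ∀ x a, x * k (.ofAdd a) = x + κ a := fun x a => by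
    rw [hadd, hκ, hckr]; simp
  refine ⟨L.toEquiv, fun x y => ?_⟩
  have hxy : x * y = x + y + κ (2⁻¹ * c x y) := by
    rw [← hmk, hadd, mul_assoc, hk]; simp
  change L (x * y) = ((L x).1 + (L y).1, (L x).2 + (L y).2 + _ * ((L x).1 ⬝ᵥ _ *ᵥ (L y).1))
  rw [hxy, map_add, map_add, hL, ← hLB, hBc]
  ext <;> simp

namespace IsHeisenbergChart

open Matrix

section Field

variable {R F l : Type*} [Group R] [Field F] [Fintype l] [DecidableEq l]
  {e : R ≃ (l ⊕ l → F) × F}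

theorem dotProduct_J_mulVec_swap (v w : l ⊕ l → F) :
    v ⬝ᵥ J l F *ᵥ w = -(w ⬝ᵥ J l F *ᵥ v) := by
  rw [dotProduct_mulVec, ← mulVec_transpose, J_transpose, neg_mulVec, neg_dotProduct,
    dotProduct_comm]

theorem fst_mul (he : IsHeisenbergChart e) (x y : R) : (e (x * y)).1 = (e x).1 + (e y).1 := by
  rw [he]

theorem snd_mul (he : IsHeisenbergChart e) (x y : R) :
    (e (x * y)).2 = (e x).2 + (e y).2 + 2⁻¹ * ((e x).1 ⬝ᵥ J l F *ᵥ (e y).1) := by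
  rw [he]

theorem apply_one (he : IsHeisenbergChart e) : e 1 = 0 := by
  have h1 : (e 1).1 = 0 := by simpa using he.fst_mul 1 1
  have h2 : (e 1).2 = 0 := by simpa [h1] using he.snd_mul 1 1
  exact Prod.ext h1 h2

theorem fst_inv (he : IsHeisenbergChart e) (x : R) : (e x⁻¹).1 = -(e x).1 := by
  have := he.fst_mul x⁻¹ x
  rw [inv_mul_cancel, he.apply_one] at this
  exact eq_neg_of_add_eq_zero_left this.symm

theorem mul_eq_mul_mul (he : IsHeisenbergChart e) (h2 : (2 : F) ≠ 0) (x y : R) :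
    x * y = y * x * e.symm (0, (e x).1 ⬝ᵥ J l F *ᵥ (e y).1) := by
  apply e.injective
  rw [he, he, he]
  simp only [Equiv.apply_symm_apply, mulVec_zero, dotProduct_zero]
  ext
  · simp [add_comm]
  · simp only
    rw [dotProduct_J_mulVec_swap (e y).1]
    field_simp
    ring

theorem symm_zero_mem_center (he : IsHeisenbergChart e) (a : F) :
    e.symm (0, a) ∈ Subgroup.center R := by
  refine Subgroup.mem_center_iff.2 fun x => e.injective ?_
  rw [he, he]
  simp [add_comm]

theorem mem_center_iff (he : IsHeisenbergChart e) (h2 : (2 : F) ≠ 0) (x : R) :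
    x ∈ Subgroup.center R ↔ (e x).1 = 0 := by
  refine ⟨fun hx => ?_, fun hx => ?_⟩
  · have h : ∀ v : l ⊕ l → F, v ⬝ᵥ J l F *ᵥ (e x).1 = 0 := fun v => by
      have h := he.mul_eq_mul_mul h2 (e.symm (v, 0)) x
      rw [Subgroup.mem_center_iff.1 hx, left_eq_mul, ← e.injective.eq_iff, he.apply_one] at h
      simpa using congrArg Prod.snd h
    have hJ : J l F *ᵥ (e x).1 = 0 := dotProduct_eq_zero _ fun v => by rw [dotProduct_comm, h]
    simpa [mulVec_mulVec, J_squared, neg_mulVec] using congrArg (J l F *ᵥ ·) hJ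
  · have := he.symm_zero_mem_center (e x).2
    rwa [← hx, Prod.mk.eta, e.symm_apply_apply] at this

/-- The automorphism of the Heisenberg group defined by a symplectic matrix. -/
def ofSymplectic (he : IsHeisenbergChart e) (A : symplecticGroup l F) : MulAut R where
  toFun x := e.symm (A.1 *ᵥ (e x).1, (e x).2)
  invFun x := e.symm ((A⁻¹).1 *ᵥ (e x).1, (e x).2)
  left_inv x := by
    simp only [Equiv.apply_symm_apply, mulVec_mulVec, ← Submonoid.coe_mul, inv_mul_cancel]
    simp
  right_inv x := by
    simp only [Equiv.apply_symm_apply, mulVec_mulVec, ← Submonoid.coe_mul, mul_inv_cancel]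
    simp
  map_mul' x y := by
    apply e.injective
    have hA : A.1ᵀ * J l F * A.1 = J l F := SymplecticGroup.mem_iff'.1 A.2
    simp only [he _ _, e.apply_symm_apply, mulVec_add]
    conv_lhs => rw [← hA]
    rw [← mulVec_mulVec, ← mulVec_mulVec, dotProduct_mulVec (e x).1, vecMul_transpose]

theorem apply_ofSymplectic (he : IsHeisenbergChart e) (A : symplecticGroup l F) (x : R) :
    e (he.ofSymplectic A x) = (A.1 *ᵥ (e x).1, (e x).2) :=
  e.apply_symm_apply _

theorem ofSymplectic_mem (he : IsHeisenbergChart e) (h2 : (2 : F) ≠ 0) (A : symplecticGroup l F) :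
    he.ofSymplectic A ∈ centralAut R := fun x hx => by
  apply e.injective
  have h := (he.mem_center_iff h2 x).1 hx
  rw [apply_ofSymplectic]
  ext1 <;> simp [h]

/-- The section of the action on the quotient by the center. -/
def symplecticSection (he : IsHeisenbergChart e) (h2 : (2 : F) ≠ 0) :
    symplecticGroup l F →* centralAut R where
  toFun A := ⟨he.ofSymplectic A, he.ofSymplectic_mem h2 A⟩
  map_one' := Subtype.ext <| MulEquiv.ext fun x => e.injective <| by
    change e (he.ofSymplectic 1 x) = e x
    rw [apply_ofSymplectic]
    simp
  map_mul' A A' := Subtype.ext <| MulEquiv.ext fun x => e.injective <| by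
    change e (he.ofSymplectic (A * A') x) = e (he.ofSymplectic A (he.ofSymplectic A' x))
    rw [apply_ofSymplectic, apply_ofSymplectic, apply_ofSymplectic]
    simp

theorem fst_apply_eq (he : IsHeisenbergChart e) (h2 : (2 : F) ≠ 0) (φ : MulAut R)
    {x y : R} (h : (e x).1 = (e y).1) : (e (φ x)).1 = (e (φ y)).1 := by
  have hc : x * y⁻¹ ∈ Subgroup.center R := by
    rw [he.mem_center_iff h2, he.fst_mul, he.fst_inv, h, add_neg_cancel]
  have hφ : φ (x * y⁻¹) ∈ Subgroup.center R := by
    refine Subgroup.mem_center_iff.2 fun w => ?_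
    obtain ⟨w, rfl⟩ := φ.surjective w
    rw [← map_mul, ← map_mul, Subgroup.mem_center_iff.1 hc]
  rw [he.mem_center_iff h2, map_mul, map_inv, he.fst_mul, he.fst_inv] at hφ
  exact add_neg_eq_zero.1 hφ

theorem preserves_form (he : IsHeisenbergChart e) (h2 : (2 : F) ≠ 0) {φ : MulAut R}
    (hφ : φ ∈ centralAut R) (x y : R) :
    (e (φ x)).1 ⬝ᵥ J l F *ᵥ (e (φ y)).1 = (e x).1 ⬝ᵥ J l F *ᵥ (e y).1 := by
  have h := congrArg φ (he.mul_eq_mul_mul h2 x y)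
  rw [map_mul, map_mul, map_mul, hφ _ (he.symm_zero_mem_center _), he.mul_eq_mul_mul h2 (φ x)]
    at h
  simpa using mul_left_cancel h

end Field

section ZMod

variable {R l : Type*} [Group R] [Fintype l] [DecidableEq l] {r : ℕ} [Fact r.Prime]
  {e : R ≃ (l ⊕ l → ZMod r) × ZMod r}

/-- The linear map on the quotient by the center induced by an automorphism. -/
def linear (he : IsHeisenbergChart e) (h2 : (2 : ZMod r) ≠ 0) (φ : MulAut R) :
    (l ⊕ l → ZMod r) →ₗ[ZMod r] (l ⊕ l → ZMod r) :=
  AddMonoidHom.toZModLinearMap r (AddMonoidHom.mk' (fun v => (e (φ (e.symm (v, 0)))).1)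
    fun v w => by
      rw [← he.fst_mul, ← map_mul]
      exact he.fst_apply_eq h2 φ (by rw [he.fst_mul]; simp))

theorem linear_apply (he : IsHeisenbergChart e) (h2 : (2 : ZMod r) ≠ 0) (φ : MulAut R) (x : R) :
    he.linear h2 φ (e x).1 = (e (φ x)).1 :=
  he.fst_apply_eq h2 φ (by simp)

theorem linear_ext (he : IsHeisenbergChart e) (h2 : (2 : ZMod r) ≠ 0) (φ : MulAut R)
    (f : (l ⊕ l → ZMod r) →ₗ[ZMod r] (l ⊕ l → ZMod r)) (h : ∀ x, (e (φ x)).1 = f (e x).1) :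
    he.linear h2 φ = f :=
  LinearMap.ext fun v => by
    have := he.linear_apply h2 φ (e.symm (v, 0))
    rw [h] at this
    simpa using this

theorem toMatrix_linear_mem (he : IsHeisenbergChart e) (h2 : (2 : ZMod r) ≠ 0) {φ : MulAut R}
    (hφ : φ ∈ centralAut R) :
    LinearMap.toMatrix' (he.linear h2 φ) ∈ symplecticGroup l (ZMod r) := by
  rw [SymplecticGroup.mem_iff']
  refine ext_of_mulVec_single fun j => dotProduct_eq _ _ fun v => ?_
  have h := he.preserves_form h2 hφ (e.symm (v, 0)) (e.symm (Pi.single j 1, 0))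
  rw [← he.linear_apply h2, ← he.linear_apply h2] at h
  simp only [Equiv.apply_symm_apply] at h
  rw [dotProduct_comm, dotProduct_comm _ v, ← h, ← mulVec_mulVec, ← mulVec_mulVec,
    dotProduct_mulVec, vecMul_transpose, LinearMap.toMatrix'_mulVec, LinearMap.toMatrix'_mulVec]

/-- The action of central automorphisms on the quotient by the center, in coordinates. -/
def toSymplectic (he : IsHeisenbergChart e) (h2 : (2 : ZMod r) ≠ 0) :
    centralAut R →* symplecticGroup l (ZMod r) where
  toFun φ := ⟨LinearMap.toMatrix' (he.linear h2 φ), he.toMatrix_linear_mem h2 φ.2⟩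
  map_one' := Subtype.ext <| by
    change LinearMap.toMatrix' _ = 1
    rw [he.linear_ext h2 _ LinearMap.id fun _ => rfl, LinearMap.toMatrix'_id]
  map_mul' φ ψ := Subtype.ext <| by
    change LinearMap.toMatrix' _ = LinearMap.toMatrix' _ * LinearMap.toMatrix' _
    rw [← LinearMap.toMatrix'_comp]
    congr 1
    refine he.linear_ext h2 _ _ fun x => ?_
    rw [LinearMap.comp_apply, linear_apply, linear_apply]
    rfl

theorem toSymplectic_eq_iff (he : IsHeisenbergChart e) (h2 : (2 : ZMod r) ≠ 0)
    (φ ψ : centralAut R) : he.toSymplectic h2 φ = he.toSymplectic h2 ψ ↔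
      ∀ x, (e ((φ : MulAut R) x)).1 = (e ((ψ : MulAut R) x)).1 := by
  rw [← Subtype.val_injective.eq_iff]
  change LinearMap.toMatrix' _ = LinearMap.toMatrix' _ ↔ _
  rw [LinearMap.toMatrix'.injective.eq_iff]
  refine ⟨fun h x => ?_, fun h => he.linear_ext h2 _ _ fun x => ?_⟩
  · rw [← he.linear_apply h2, h, linear_apply]
  · rw [h, linear_apply]

theorem toSymplectic_symplecticSection (he : IsHeisenbergChart e) (h2 : (2 : ZMod r) ≠ 0)
    (A : symplecticGroup l (ZMod r)) : he.toSymplectic h2 (he.symplecticSection h2 A) = A := by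
  refine Subtype.ext ?_
  change LinearMap.toMatrix' (he.linear h2 (he.ofSymplectic A)) = A.1
  rw [he.linear_ext h2 _ (Matrix.toLin' A.1), LinearMap.toMatrix'_toLin']
  exact fun x => by rw [apply_ofSymplectic, toLin'_apply]

theorem exists_conj_eq (he : IsHeisenbergChart e) (h2 : (2 : ZMod r) ≠ 0) {φ : MulAut R}
    (hφ : φ ∈ centralAut R) (h : ∀ x, (e (φ x)).1 = (e x).1) : ∃ g, MulAut.conj g = φ := by
  have hsplit : ∀ x, x = e.symm ((e x).1, 0) * e.symm (0, (e x).2) := fun x =>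
    e.injective <| by rw [he]; simp
  have hsnd : ∀ x, (e (φ x)).2 = (e x).2 + (e (φ (e.symm ((e x).1, 0)))).2 := fun x => by
    conv_lhs => rw [hsplit x, map_mul, hφ _ (he.symm_zero_mem_center _), he.snd_mul]
    simp [add_comm]
  let f : (l ⊕ l → ZMod r) →ₗ[ZMod r] ZMod r :=
    AddMonoidHom.toZModLinearMap r (AddMonoidHom.mk' (fun v => (e (φ (e.symm (v, 0)))).2)
      fun v w => by
        have := hsnd (e.symm (v, 0) * e.symm (w, 0))
        rw [map_mul, he.snd_mul, he.snd_mul, he.fst_mul, h, h] at this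
        simp only [Equiv.apply_symm_apply] at this
        linear_combination -this)
  obtain ⟨u, hu⟩ : ∃ u, ∀ v, f v = u ⬝ᵥ J l (ZMod r) *ᵥ v := by
    refine ⟨J l (ZMod r) *ᵥ fun i => f (Pi.single i 1), fun v => ?_⟩
    rw [dotProduct_J_mulVec_swap, mulVec_mulVec, J_squared, neg_mulVec, one_mulVec,
      dotProduct_neg, neg_neg]
    conv_lhs => rw [pi_eq_sum_univ' v]
    simp [dotProduct]
  refine ⟨e.symm (u, 0), MulEquiv.ext fun x => ?_⟩
  rw [MulAut.conj_apply, mul_inv_eq_iff_eq_mul, he.mul_eq_mul_mul h2,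
    Subgroup.mem_center_iff.1 (he.symm_zero_mem_center _), ← mul_assoc, mul_left_inj,
    ← Subgroup.mem_center_iff.1 (he.symm_zero_mem_center _)]
  apply e.injective
  rw [he]
  ext1
  · simp [h]
  · rw [hsnd]
    simpa [f] using (hu _).symm

end ZMod

end IsHeisenbergChart

/-- Let `R` be an extraspecial `r`-group of order `r^{1+2n}` and
exponent `r`, for an odd prime `r`. Then the short exact sequence
`1 → Inn(R) → C_{Aut(R)}(Z(R)) → Sp_{2n}(r) → 1` splits: there is a surjective
homomorphism `θ` from `A := C_{Aut(R)}(Z(R))` onto `Sp_{2n}(r)` with kernel `Inn(R)`,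
factoring through the action of `A` on `R/Z(R)`, which admits a homomorphic section. -/
theorem stmt_10 (r n : ℕ) (hr : r.Prime) (hodd : r ≠ 2)
    (R : Type*) [Group R] [Finite R]
    (hext : IsExtraspecial r R) (hcard : Nat.card R = r ^ (1 + 2 * n))
    (hexp : ∀ x : R, x ^ r = 1) :
    ∃ θ : ↥(centralAut R) →* Matrix.symplecticGroup (Fin n) (ZMod r),
      Function.Surjective θ ∧
      θ.ker = (MulAut.conj (G := R)).range.subgroupOf (centralAut R) ∧
      (∀ φ ψ : ↥(centralAut R),
        (∀ x : R, (φ : MulAut R) x * ((ψ : MulAut R) x)⁻¹ ∈ Subgroup.center R) → θ φ = θ ψ) ∧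
      ∃ σ : Matrix.symplecticGroup (Fin n) (ZMod r) →* ↥(centralAut R),
        θ.comp σ = MonoidHom.id _ := by
  have : Fact r.Prime := ⟨hr⟩
  have h2 : (2 : ZMod r) ≠ 0 := ZMod.two_ne_zero_of_prime_of_ne_two hr hodd
  obtain ⟨e, he⟩ := hext.exists_heisenberg_coords h2 hcard hexp
  refine ⟨he.toSymplectic h2, fun A => ⟨_, he.toSymplectic_symplecticSection h2 A⟩, ?_,
    fun φ ψ h => ?_, he.symplecticSection h2, MonoidHom.ext (he.toSymplectic_symplecticSection h2)⟩
  · ext φ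
    rw [MonoidHom.mem_ker, Subgroup.mem_subgroupOf, ← map_one (he.toSymplectic h2),
      he.toSymplectic_eq_iff h2]
    refine ⟨fun h => he.exists_conj_eq h2 φ.2 h, ?_⟩
    rintro ⟨g, hg⟩ x
    rw [← hg, MulAut.conj_apply, he.fst_mul, he.fst_mul, he.fst_inv]
    simp
  · refine (he.toSymplectic_eq_iff h2 φ ψ).2 fun x => ?_
    have := h x
    rw [he.mem_center_iff h2, he.fst_mul, he.fst_inv] at this
    exact add_neg_eq_zero.1 this
end

section
/- Let T be a finite nonabelian simple group, ℓ ≥ 1, and G = T^ℓ. Define n'_G to be the minimal n such that G has a faithful irreducible representation into GL_{2n}(2). Then n'_G ≥ n'_T · 2^{ℓ−1}. -/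
/-- `n'_G`: the minimal `n` such that `G` has a faithful irreducible representation into
`GL_{2n}(2)`. -/
noncomputable def nPrime (G : Type*) [Group G] : ℕ :=
  sInf {n : ℕ | ∃ ρ : G →* GL (Fin (2 * n)) (ZMod 2), Function.Injective ρ ∧
    ∀ W : Submodule (ZMod 2) (Fin (2 * n) → ZMod 2),
      (∀ g : G, ∀ v ∈ W,
        Matrix.mulVec ((ρ g : Matrix (Fin (2 * n)) (Fin (2 * n)) (ZMod 2))) v ∈ W) →
      W = ⊥ ∨ W = ⊤}

section CommutingActions

variable {S V : Type*} [Ring S] [AddCommGroup V] [Module S V]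

/-- The module `V` has no proper nonzero `S`-submodule stable under all endomorphisms in `Φ`. -/
def IsJointlySimple (Φ : Set (Module.End S V)) : Prop :=
  ∀ U : Submodule S V, (∀ φ ∈ Φ, ∀ u ∈ U, φ u ∈ U) → U = ⊥ ∨ U = ⊤

theorem IsJointlySimple.isotypicComponent_eq_top {Φ : Set (Module.End S V)}
    (h : IsJointlySimple Φ) (W : Submodule S V) [IsSimpleModule S W] :
    isotypicComponent S V W = ⊤ :=
  (h _ fun φ _ _ hu => Submodule.IsFullyInvariant.isotypicComponent S V W φ hu).resolve_left
    (bot_lt_isotypicComponent W).ne'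

theorem IsJointlySimple.isIsotypicOfType {Φ : Set (Module.End S V)}
    (h : IsJointlySimple Φ) (W : Submodule S V) [IsSimpleModule S W] :
    IsIsotypicOfType S V W :=
  .of_isotypicComponent_eq_top (h.isotypicComponent_eq_top W)

theorem IsJointlySimple.isSemisimpleModule {Φ : Set (Module.End S V)}
    (h : IsJointlySimple Φ) (W : Submodule S V) [IsSimpleModule S W] :
    IsSemisimpleModule S V := by
  have : IsSemisimpleModule S (⊤ : Submodule S V) := by
    rw [← h.isotypicComponent_eq_top W]; infer_instance
  exact .congr Submodule.topEquiv.symm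

theorem IsJointlySimple.exists_linearEquiv_fun [Finite V] {Φ : Set (Module.End S V)}
    (h : IsJointlySimple Φ) (W : Submodule S V) [IsSimpleModule S W] :
    ∃ m : ℕ, Nonempty (V ≃ₗ[S] (Fin m → W)) :=
  have := h.isSemisimpleModule W
  (h.isIsotypicOfType W).linearEquiv_fun

theorem exists_isSimpleModule_submodule [Finite V] [Nontrivial V] :
    ∃ W : Submodule S V, IsSimpleModule S W := by
  obtain ⟨W, hW, -⟩ := (eq_bot_or_exists_atom_le (⊤ : Submodule S V)).resolve_left top_ne_bot
  exact ⟨W, isSimpleModule_iff_isAtom.2 hW⟩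

theorem IsJointlySimple.mem_of_stable [Finite V] {Φ : Set (Module.End S V)}
    (h : IsJointlySimple Φ) (W : Submodule S V) [IsSimpleModule S W]
    (U : AddSubgroup (W →ₗ[S] V)) (hU : U ≠ ⊥) (hΦ : ∀ φ ∈ Φ, ∀ u ∈ U, φ ∘ₗ u ∈ U)
    (hE : ∀ e : Module.End S W, ∀ u ∈ U, u ∘ₗ e ∈ U) : U = ⊤ := by
  have := h.isSemisimpleModule W
  have : Finite (W →ₗ[S] V) := DFunLike.finite _
  have : Fintype U := Fintype.ofFinite _
  let π : (U → W) →ₗ[S] V := ∑ u : U, u.1 ∘ₗ LinearMap.proj u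
  have hπ : ∀ x, π x = ∑ u : U, u.1 (x u) := fun x => by simp [π]
  classical
  have hsingle : ∀ (u : U) w, π (Pi.single u w) = u.1 w := fun u w => by
    rw [hπ, Finset.sum_eq_single u] <;> simp +contextual
  have htop : LinearMap.range π = ⊤ := by
    refine (h _ ?_).resolve_left ?_
    · rintro φ hφ _ ⟨x, rfl⟩
      rw [hπ, map_sum]
      refine sum_mem fun u _ => ⟨Pi.single ⟨φ ∘ₗ u.1, hΦ φ hφ _ u.2⟩ (x u), ?_⟩
      rw [hsingle]; rfl
    · intro hbot
      refine hU ((AddSubgroup.eq_bot_iff_forall _).2 fun u hu => LinearMap.ext fun w => ?_)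
      have : π (Pi.single ⟨u, hu⟩ w) ∈ LinearMap.range π := ⟨_, rfl⟩
      rw [hbot, Submodule.mem_bot, hsingle] at this
      exact this
  have hs : ∃ σ : V →ₗ[S] (U → W), π ∘ₗ σ = LinearMap.id := by
    exact IsSemisimpleModule.lifting_property π (LinearMap.range_eq_top.1 htop) LinearMap.id
  obtain ⟨σ, hσ⟩ := hs
  refine (AddSubgroup.eq_top_iff' _).2 fun f => ?_
  have : f = ∑ u : U, u.1 ∘ₗ (LinearMap.proj u ∘ₗ σ ∘ₗ f) := by
    ext w
    have := hπ (σ (f w))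
    rw [← LinearMap.comp_apply, hσ] at this
    simpa using this
  rw [this]
  exact sum_mem fun u _ => hE _ _ u.2

theorem IsJointlySimple.card_hom_eq [Finite V] {Φ : Set (Module.End S V)}
    (h : IsJointlySimple Φ) (W : Submodule S V) [IsSimpleModule S W] :
    ∃ m : ℕ, Nat.card V = Nat.card W ^ m ∧
      Nat.card (W →ₗ[S] V) = Nat.card (Module.End S W) ^ m := by
  obtain ⟨m, ⟨e⟩⟩ := h.exists_linearEquiv_fun W
  refine ⟨m, by rw [Nat.card_congr e.toEquiv, Nat.card_fun, Nat.card_fin], ?_⟩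
  let e' : (W →ₗ[S] V) ≃ (Fin m → Module.End S W) :=
    { toFun := fun f i => LinearMap.proj i ∘ₗ e.toLinearMap ∘ₗ f
      invFun := fun g => e.symm.toLinearMap ∘ₗ LinearMap.pi g
      left_inv := fun f => by ext w; simp [LinearMap.pi]
      right_inv := fun g => by ext i w; simp }
  rw [Nat.card_congr e', Nat.card_fun, Nat.card_fin]

/-- A type whose cardinality is an odd power of two. -/
def HasOddDim (X : Type*) : Prop := ∃ c, Odd c ∧ Nat.card X = 2 ^ c

theorem commute_end_of_isSimpleModule [Finite V] [IsSimpleModule S V] (f g : Module.End S V) :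
    f * g = g * f := by
  classical
  have : Finite (Module.End S V) := DFunLike.finite _
  exact (littleWedderburn (Module.End S V)).mul_comm f g

theorem HasOddDim.exists_card_end [Finite V] [IsSimpleModule S V] (h : HasOddDim V) :
    ∃ a, Odd a ∧ Nat.card (Module.End S V) = 2 ^ a ∧
      ∀ f : Module.End S V, f ^ 2 ^ a = f := by
  classical
  have : Finite (Module.End S V) := DFunLike.finite _
  obtain ⟨c, hc, hV⟩ := h
  have h1 : Nat.card V = Nat.card (Module.End S V) ^ Module.finrank (Module.End S V) V :=
    Module.natCard_eq_pow_finrank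
  have h2 : Nat.card (Module.End S V) ∣ 2 ^ c := by
    rw [← hV, h1]
    refine dvd_pow_self _ fun h0 => ?_
    rw [h0, pow_zero, hV] at h1
    have := hc.pos
    exact absurd h1 (Nat.one_lt_two_pow this.ne').ne'
  obtain ⟨a, ha, hE⟩ := (Nat.dvd_prime_pow Nat.prime_two).1 h2
  refine ⟨a, ?_, hE, fun f => ?_⟩
  · rw [hE, hV, ← pow_mul] at h1
    have := Nat.pow_right_injective le_rfl h1
    rw [this] at hc
    exact (Nat.odd_mul.1 hc).1
  · rw [← hE]
    by_cases hf : f = 0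
    · subst hf; rw [zero_pow Nat.card_pos.ne']
    · have := pow_card_eq_one' (x := Units.mk0 f hf)
      rw [Nat.card_units] at this
      have h3 := congrArg Units.val this
      simp only [Units.val_pow_eq_pow_val, Units.val_mk0, Units.val_one] at h3
      rw [← Nat.sub_add_cancel (Nat.card_pos : 0 < Nat.card (Module.End S V)), pow_succ, h3,
        one_mul]

theorem exists_card_eq_two_pow_dvd {X : Type*} [AddCommGroup X] [Finite X] [Nontrivial X]
    (h2 : ∀ x : X, x + x = 0) (Γ : Set (AddMonoid.End X)) (hcomm : ∀ f ∈ Γ, ∀ g ∈ Γ, f * g = g * f)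
    (N : ℕ) (hN : ∀ f ∈ Γ, f ^ 2 ^ N = f)
    (hX : ∀ U : AddSubgroup X, (∀ f ∈ Γ, ∀ u ∈ U, f u ∈ U) → U = ⊥ ∨ U = ⊤) :
    ∃ c, c ∣ N ∧ Nat.card X = 2 ^ c := by
  let D := Subring.closure Γ
  let _ : CommRing D :=
    { (inferInstance : Ring D) with
      mul_comm := (Subring.isMulCommutative_closure hcomm).is_comm.comm }
  have hchar : (2 : D) = 0 := by
    ext x
    change (2 : AddMonoid.End X) x = 0
    rw [← one_add_one_eq_two]
    exact h2 x
  have : Nontrivial D := by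
    obtain ⟨x, hx⟩ := exists_ne (0 : X)
    refine ⟨⟨1, 0, fun h => hx ?_⟩⟩
    exact congrArg (fun d : D => (d : AddMonoid.End X) x) h
  have : CharP D 2 := CharTwo.of_one_ne_zero_of_two_eq_zero one_ne_zero hchar
  have hD : ∀ d : D, d ^ 2 ^ N = d := by
    rintro ⟨d, hd⟩
    induction hd using Subring.closure_induction with
    | mem x hx => exact Subtype.ext (hN x hx)
    | zero => exact zero_pow (by positivity)
    | one => exact one_pow _
    | add x y hx hy h1 h2 =>
      exact (add_pow_char_pow (x := (⟨x, hx⟩ : D)) (y := ⟨y, hy⟩) 2 N).trans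
        (congrArg₂ (· + ·) h1 h2)
    | neg x hx h =>
      refine Eq.trans (?_ : _ = (-⟨x, hx⟩ : D) ^ 2 ^ N) ?_
      · rfl
      · rw [CharTwo.neg_eq, h]
        exact (CharTwo.neg_eq (⟨x, hx⟩ : D)).symm
    | mul x y hx hy h1 h2 =>
      exact (mul_pow (⟨x, hx⟩ : D) ⟨y, hy⟩ _).trans (congrArg₂ (· * ·) h1 h2)
  have hsimple : IsSimpleModule D X := by
    refine { toIsSimpleOrder :=
      { exists_pair_ne := ⟨⊥, ⊤, bot_ne_top⟩, eq_bot_or_eq_top := fun U => ?_ } }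
    refine (hX U.toAddSubgroup fun f hf u hu =>
      U.smul_mem (⟨f, Subring.subset_closure hf⟩ : D) hu).imp (fun h => ?_) fun h => ?_
    · exact Submodule.toAddSubgroup_injective h
    · exact Submodule.toAddSubgroup_injective h
  obtain ⟨I, hI, ⟨e⟩⟩ := isSimpleModule_iff_quot_maximal.1 hsimple
  let _ : Field (D ⧸ I) := Ideal.Quotient.field I
  have : Finite (D ⧸ I) := Finite.of_equiv X e.toEquiv
  have : CharP (D ⧸ I) 2 := CharTwo.of_one_ne_zero_of_two_eq_zero one_ne_zero
    ((map_ofNat (Ideal.Quotient.mk I) 2).symm.trans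
      ((congrArg (Ideal.Quotient.mk I) hchar).trans (map_zero _)))
  have hK : ∀ x : D ⧸ I, x ^ 2 ^ N = x := fun x => by
    obtain ⟨d, rfl⟩ := Ideal.Quotient.mk_surjective x
    rw [← map_pow, hD]
  have := ZMod.algebra (D ⧸ I) 2
  have : Fact (Nat.Prime 2) := ⟨Nat.prime_two⟩
  have : Fintype (D ⧸ I) := Fintype.ofFinite _
  refine ⟨Module.finrank (ZMod 2) (D ⧸ I), ?_, ?_⟩
  · rw [← FiniteField.orderOf_frobeniusAlgHom (ZMod 2) (D ⧸ I)]
    refine orderOf_dvd_of_pow_eq_one (AlgHom.ext fun x => ?_)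
    simp_rw [AlgHom.coe_pow, FiniteField.coe_frobeniusAlgHom, pow_iterate, AlgHom.one_apply,
      ZMod.card]
    exact hK x
  · rw [Nat.card_congr e.toEquiv, Module.natCard_eq_pow_finrank (K := ZMod 2), Nat.card_zmod]

section Pair

variable (R : Type*) [Ring R] [Module R V] [SMulCommClass S R V] [SMulCommClass R S V]

/-- The scalar multiplications by elements of `R`, as `S`-linear endomorphisms. -/
def smulEnds (S R V : Type*) [Ring S] [AddCommGroup V] [Module S V] [Ring R] [Module R V]
    [SMulCommClass R S V] : Set (Module.End S V) :=
  {φ | ∃ r : R, ∀ v, φ v = r • v}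

theorem hasOddDim_of_isJointlySimple [Finite V] [Nontrivial V] (h2 : ∀ v : V, v + v = 0)
    (h : IsJointlySimple (smulEnds S R V))
    (hS : ∀ W : Submodule S V, IsSimpleModule S W → HasOddDim W)
    (hR : ∀ L : Submodule R V, IsSimpleModule R L → HasOddDim L) : HasOddDim V := by
  obtain ⟨W, hW⟩ := exists_isSimpleModule_submodule (S := S) (V := V)
  let H := W →ₗ[S] V
  have : Finite H := DFunLike.finite _
  have : Nontrivial W := IsSimpleModule.nontrivial S W
  have : Nontrivial H := by
    refine ⟨⟨W.subtype, 0, fun h0 => ?_⟩⟩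
    obtain ⟨w, hw⟩ := exists_ne (0 : W)
    exact hw (Subtype.ext (congrArg (fun f : H => f w) h0))
  let pre (e : Module.End S W) : Module.End R H :=
    { toFun := fun u => u ∘ₗ e
      map_add' := fun _ _ => rfl
      map_smul' := fun _ _ => rfl }
  have hH : IsJointlySimple (Set.range pre) := by
    intro U hU
    by_cases hbot : U = ⊥
    · exact .inl hbot
    right
    refine Submodule.toAddSubgroup_injective ?_
    refine h.mem_of_stable W U.toAddSubgroup (fun h0 => hbot (Submodule.toAddSubgroup_injective h0))
      ?_ fun e u hu => hU _ ⟨e, rfl⟩ u hu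
    rintro φ ⟨r, hr⟩ u hu
    have : φ ∘ₗ u = r • u := LinearMap.ext fun w => hr _
    rw [this]
    exact U.smul_mem r hu
  obtain ⟨L, hL⟩ := exists_isSimpleModule_submodule (S := R) (V := H)
  have hLodd : HasOddDim L := by
    have : Nontrivial L := IsSimpleModule.nontrivial R L
    obtain ⟨⟨u, huL⟩, hu⟩ := exists_ne (0 : L)
    have hu0 : u ≠ 0 := fun h0 => hu (Subtype.ext h0)
    obtain ⟨w, hw⟩ : ∃ w, u w ≠ 0 := by
      by_contra! hall
      exact hu0 (LinearMap.ext hall)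
    let ev : L →ₗ[R] V :=
      { toFun := fun f => f.1 w
        map_add' := fun _ _ => rfl
        map_smul' := fun _ _ => rfl }
    have hinj : Function.Injective ev :=
      LinearMap.injective_of_ne_zero fun h0 => hw (congrArg (fun f : L →ₗ[R] V => f ⟨u, huL⟩) h0)
    let e := LinearEquiv.ofInjective ev hinj
    have := IsSimpleModule.congr e.symm
    obtain ⟨c, hc, hcard⟩ := hR _ this
    exact ⟨c, hc, (Nat.card_congr e.toEquiv).trans hcard⟩
  obtain ⟨m, hV, hHE⟩ := h.card_hom_eq W
  obtain ⟨s, hHL, hXF⟩ := hH.card_hom_eq L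
  obtain ⟨a, ha, hEa, hE⟩ := (hS W hW).exists_card_end (S := S)
  obtain ⟨b, hb, hFb, hF⟩ := hLodd.exists_card_end (S := R)
  obtain ⟨w, hw, hWw⟩ := hS W hW
  obtain ⟨l, hl, hLl⟩ := hLodd
  let X := L →ₗ[R] H
  have : Finite X := DFunLike.finite _
  have : Nontrivial X := by
    have : Nontrivial L := IsSimpleModule.nontrivial R L
    refine ⟨⟨L.subtype, 0, fun h0 => ?_⟩⟩
    obtain ⟨w, hw⟩ := exists_ne (0 : L)
    exact hw (Subtype.ext (congrArg (fun f : X => f w) h0))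
  let α (e : Module.End S W) : AddMonoid.End X :=
    { toFun := fun u => pre e ∘ₗ u
      map_zero' := LinearMap.comp_zero _
      map_add' := fun _ _ => LinearMap.comp_add _ _ _ }
  let β (f : Module.End R L) : AddMonoid.End X :=
    { toFun := fun u => u ∘ₗ f
      map_zero' := LinearMap.zero_comp _
      map_add' := fun _ _ => rfl }
  have hα : ∀ e e', α e * α e' = α (e' * e) := fun _ _ => rfl
  have hβ : ∀ e e', β e * β e' = β (e' * e) := fun _ _ => rfl
  have hαβ : ∀ e f, α e * β f = β f * α e := fun _ _ => rfl
  have hαpow : ∀ e n, α e ^ n = α (e ^ n) := fun e n => by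
    induction n with
    | zero => rfl
    | succ n ih => rw [pow_succ, ih, hα, pow_succ']
  have hβpow : ∀ e n, β e ^ n = β (e ^ n) := fun e n => by
    induction n with
    | zero => rfl
    | succ n ih => rw [pow_succ, ih, hβ, pow_succ']
  have hiter : ∀ {M : Type _} [Monoid M] (x : M) (n k : ℕ),
      x ^ 2 ^ n = x → x ^ 2 ^ (n * k) = x := by
    intro M _ x n k hx
    induction k with
    | zero => simp
    | succ k ih => rw [Nat.mul_succ, pow_add, pow_mul, ih, hx]
  obtain ⟨c, hcdvd, hXc⟩ := exists_card_eq_two_pow_dvd (X := X)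
    (fun x => LinearMap.ext fun _ => LinearMap.ext fun _ => h2 _)
    (Set.range α ∪ Set.range β)
    (by
      rintro _ (⟨e, rfl⟩ | ⟨f, rfl⟩) _ (⟨e', rfl⟩ | ⟨f', rfl⟩)
      · rw [hα, hα, commute_end_of_isSimpleModule]
      · rw [hαβ]
      · rw [hαβ]
      · rw [hβ, hβ, commute_end_of_isSimpleModule])
    (a * b)
    (by
      rintro _ (⟨e, rfl⟩ | ⟨f, rfl⟩)
      · rw [hαpow, hiter _ _ _ (hE e)]
      · rw [hβpow, mul_comm a b, hiter _ _ _ (hF f)])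
    (by
      intro U hU
      by_cases hbot : U = ⊥
      · exact .inl hbot
      right
      refine hH.mem_of_stable L U hbot ?_ fun f u hu => hU _ (.inr ⟨f, rfl⟩) u hu
      rintro _ ⟨e, rfl⟩ u hu
      exact hU _ (.inl ⟨e, rfl⟩) u hu)
  have hinj := Nat.pow_right_injective (le_refl 2)
  have hc : Odd c := (ha.mul hb).of_dvd_nat hcdvd
  have hcs : c = b * s := hinj (by
    change 2 ^ c = 2 ^ (b * s)
    rw [← hXc, pow_mul, ← hFb]; exact hXF)
  have hs : Odd s := (Nat.odd_mul.1 (hcs ▸ hc)).2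
  have hls : l * s = a * m := hinj (by
    change 2 ^ (l * s) = 2 ^ (a * m)
    rw [pow_mul, pow_mul, ← hEa, ← hLl, ← hHE, ← hHL])
  have hm : Odd m := (Nat.odd_mul.1 (hls ▸ hl.mul hs)).2
  exact ⟨w * m, hw.mul hm, by rw [pow_mul, ← hWw, hV]⟩

omit [SMulCommClass S R V] in
theorem sq_card_le_of_isJointlySimple [Finite V] (h : IsJointlySimple (smulEnds S R V))
    (hR : ∃ (r r' : R) (v : V), r • r' • v ≠ r' • r • v)
    (W : Submodule S V) [IsSimpleModule S W] : Nat.card W ^ 2 ≤ Nat.card V := by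
  obtain ⟨m, ⟨e⟩⟩ := h.exists_linearEquiv_fun W
  have hV : Nat.card V = Nat.card W ^ m := by
    rw [Nat.card_congr e.toEquiv, Nat.card_fun, Nat.card_fin]
  rw [hV]
  refine Nat.pow_le_pow_right Nat.card_pos ?_
  by_contra! hm
  obtain ⟨r, r', v, hv⟩ := hR
  interval_cases m
  · exact hv (e.injective (Subsingleton.elim _ _))
  · have : IsSimpleModule S V := IsSimpleModule.congr (e.trans (LinearEquiv.funUnique (Fin 1) S W))
    exact hv (congrArg (fun f : Module.End S V => f v)
      (commute_end_of_isSimpleModule (S := S) (V := V) (DistribSMul.toLinearMap S V r)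
        (DistribSMul.toLinearMap S V r')))

end Pair

end CommutingActions

section MinimalStable

variable {V : Type*} [AddCommGroup V]

/-- The subgroup `U` is mapped to itself by all endomorphisms in `Φ`. -/
def IsStable (Φ : Set (AddMonoid.End V)) (U : AddSubgroup V) : Prop :=
  ∀ φ ∈ Φ, ∀ u ∈ U, φ u ∈ U

/-- The subgroup `X` is a minimal nonzero subgroup among those stable under `Φ`. -/
structure IsMinStable (Φ : Set (AddMonoid.End V)) (X : AddSubgroup V) : Prop where
  ne_bot : X ≠ ⊥
  stable : IsStable Φ X
  eq_bot_or_eq : ∀ U ≤ X, IsStable Φ U → U = ⊥ ∨ U = X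

/-- The ring of endomorphisms of `X` generated by the restrictions of the elements of `Φ`. -/
def restrictRing (Φ : Set (AddMonoid.End V)) (X : AddSubgroup V) : Subring (AddMonoid.End X) :=
  Subring.closure {f | ∃ φ ∈ Φ, ∀ x : X, (f x : V) = φ x}

variable {Φ Ψ : Set (AddMonoid.End V)} {X : AddSubgroup V}

/-- The restriction of `φ` to `X`, as an element of `restrictRing Φ X`. -/
def restrictEnd (hX : IsStable Φ X) (φ : AddMonoid.End V) (hφ : φ ∈ Φ) : restrictRing Φ X :=
  ⟨AddMonoidHom.codRestrict (AddMonoidHom.comp φ X.subtype) X fun x => hX φ hφ x x.2,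
    Subring.subset_closure ⟨φ, hφ, fun _ => rfl⟩⟩

theorem smul_mem_of_stable {U : AddSubgroup X}
    (hU : ∀ φ ∈ Φ, ∀ u ∈ U, ∀ x : X, (x : V) = φ u → x ∈ U)
    (a : restrictRing Φ X)
    {u : X} (hu : u ∈ U) : a • u ∈ U := by
  obtain ⟨a, ha⟩ := a
  change a u ∈ U
  induction ha using Subring.closure_induction generalizing u with
  | mem f hf =>
    obtain ⟨φ, hφ, hf⟩ := hf
    exact hU φ hφ u hu _ (hf u)
  | zero => exact U.zero_mem
  | one => exact hu
  | add f g _ _ h1 h2 => exact U.add_mem (h1 hu) (h2 hu)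
  | neg f _ h => exact U.neg_mem (h hu)
  | mul f g _ _ h1 h2 => exact h1 (h2 hu)

/-- A stable subgroup, as a submodule over `restrictRing Φ X`. -/
def stableSubmodule (X U : AddSubgroup V) (hU : IsStable Φ U) : Submodule (restrictRing Φ X) X :=
  { U.comap X.subtype with
    smul_mem' := fun a _ hu => smul_mem_of_stable (U := U.comap X.subtype)
      (fun φ hφ u hu _ hx => (congrArg (· ∈ U) hx).mpr (hU φ hφ u hu)) a hu }

theorem isStable_map (hX : IsStable Φ X) (L : Submodule (restrictRing Φ X) X) :
    IsStable Φ (L.toAddSubgroup.map X.subtype) := by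
  rintro φ hφ _ ⟨x, hx, rfl⟩
  exact ⟨restrictEnd hX φ hφ • x, L.smul_mem _ hx, rfl⟩

theorem card_map_subtype (L : AddSubgroup X) : Nat.card (L.map X.subtype) = Nat.card L :=
  (Nat.card_congr (L.equivMapOfInjective X.subtype Subtype.val_injective).toEquiv).symm

theorem eq_map_of_stableSubmodule_eq (L : Submodule (restrictRing Φ X) X)
    (U : AddSubgroup V) (hU : IsStable Φ U) (h : stableSubmodule X U hU = L) (hUX : U ≤ X) :
    U = L.toAddSubgroup.map X.subtype := by
  subst h
  ext v
  exact ⟨fun hv => ⟨⟨v, hUX hv⟩, hv, rfl⟩, by rintro ⟨x, hx, rfl⟩; exact hx⟩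

theorem isMinStable_map (hX : IsStable Φ X) (L : Submodule (restrictRing Φ X) X)
    [IsSimpleModule (restrictRing Φ X) L] : IsMinStable Φ (L.toAddSubgroup.map X.subtype) := by
  have hL := isSimpleModule_iff_isAtom.1 ‹_›
  refine ⟨fun h => hL.1 ?_, isStable_map hX L, fun U hUL hU => ?_⟩
  · rw [AddSubgroup.map_eq_bot_iff_of_injective _ Subtype.val_injective] at h
    exact Submodule.toAddSubgroup_injective h
  · have hUX : U ≤ X := hUL.trans (by rintro _ ⟨x, -, rfl⟩; exact x.2)
    have hle : stableSubmodule X U hU ≤ L := fun x hx => by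
      obtain ⟨y, hy, hyx⟩ := hUL hx
      rwa [← Subtype.ext hyx]
    refine (hL.le_iff.1 hle).imp (fun h => ?_) fun h => ?_
    · rw [eq_map_of_stableSubmodule_eq _ U hU h hUX]
      exact AddSubgroup.map_bot _
    · exact eq_map_of_stableSubmodule_eq L U hU h hUX

theorem IsMinStable.isSimpleModule {W : AddSubgroup V} (hW : IsMinStable Φ W)
    (hX : IsStable Φ X) (hWX : W ≤ X) :
    IsSimpleModule (restrictRing Φ X) (stableSubmodule X W hW.stable) := by
  refine isSimpleModule_iff_isAtom.2 ⟨fun h => hW.ne_bot ?_, fun L hL => ?_⟩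
  · rw [eq_map_of_stableSubmodule_eq _ W hW.stable h hWX]
    exact AddSubgroup.map_bot _
  · have hle : L.toAddSubgroup.map X.subtype ≤ W := by
      rintro _ ⟨x, hx, rfl⟩
      exact hL.le hx
    refine (hW.eq_bot_or_eq _ hle (isStable_map hX L)).elim (fun h => ?_) fun h => ?_
    · rw [AddSubgroup.map_eq_bot_iff_of_injective _ Subtype.val_injective] at h
      exact Submodule.toAddSubgroup_injective h
    · refine absurd ?_ hL.not_ge
      intro x hx
      obtain ⟨y, hy, hyx⟩ := h.ge (show (x : V) ∈ W from hx)
      rwa [← Subtype.ext hyx]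

theorem card_stableSubmodule (W : AddSubgroup V) (hW : IsStable Φ W) (hWX : W ≤ X) :
    Nat.card (stableSubmodule X W hW) = Nat.card W :=
  Nat.card_congr
    { toFun := fun x => ⟨x.1.1, x.2⟩
      invFun := fun w => ⟨⟨w.1, hWX w.2⟩, w.2⟩
      left_inv := fun _ => rfl
      right_inv := fun _ => rfl }

theorem commute_restrictRing (hc : ∀ φ ∈ Φ, ∀ ψ ∈ Ψ, Commute φ ψ) {f g : AddMonoid.End X}
    (hf : f ∈ restrictRing Φ X) (hg : g ∈ restrictRing Ψ X) : Commute f g := by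
  have hgen : ∀ f' ∈ {f : AddMonoid.End X | ∃ φ ∈ Φ, ∀ x : X, (f x : V) = φ x},
      ∀ g' ∈ {g : AddMonoid.End X | ∃ ψ ∈ Ψ, ∀ x : X, (g x : V) = ψ x}, g' * f' = f' * g' := by
    rintro f' ⟨φ, hφ, hf⟩ g' ⟨ψ, hψ, hg⟩
    ext x
    change ((g' (f' x) : X) : V) = (f' (g' x) : X)
    rw [hf, hg, hf, hg]
    exact (DFunLike.congr_fun (hc φ hφ ψ hψ) (x : V)).symm
  have h1 : restrictRing Φ X ≤ Subring.centralizer _ := Subring.closure_le.2 fun f' hf' =>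
    Subring.mem_centralizer_iff.2 (hgen f' hf')
  have h2 : restrictRing Ψ X ≤ Subring.centralizer (restrictRing Φ X) :=
    Subring.closure_le.2 fun g' hg' => Subring.mem_centralizer_iff.2 fun f' hf' =>
      (Subring.mem_centralizer_iff.1 (h1 hf') g' hg').symm
  exact Subring.mem_centralizer_iff.1 (h2 hg) f hf

theorem smulCommClass_restrictRing (hc : ∀ φ ∈ Φ, ∀ ψ ∈ Ψ, Commute φ ψ) :
    SMulCommClass (restrictRing Φ X) (restrictRing Ψ X) X :=
  ⟨fun f g x => DFunLike.congr_fun (commute_restrictRing hc f.2 g.2) x⟩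

theorem IsMinStable.isJointlySimple (hX : IsMinStable (Φ ∪ Ψ) X)
    [SMulCommClass (restrictRing Ψ X) (restrictRing Φ X) X] :
    IsJointlySimple (smulEnds (restrictRing Φ X) (restrictRing Ψ X) X) := by
  intro U hU
  have hXΦ : IsStable Φ X := fun φ hφ => hX.stable φ (.inl hφ)
  have hXΨ : IsStable Ψ X := fun φ hφ => hX.stable φ (.inr hφ)
  have hstab : IsStable (Φ ∪ Ψ) (U.toAddSubgroup.map X.subtype) := by
    rintro φ (hφ | hφ)
    · exact isStable_map hXΦ U φ hφ
    · rintro _ ⟨x, hx, rfl⟩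
      exact ⟨restrictEnd hXΨ φ hφ • x,
        hU (DistribSMul.toLinearMap _ X (restrictEnd hXΨ φ hφ))
          ⟨restrictEnd hXΨ φ hφ, fun _ => rfl⟩ x hx, rfl⟩
  refine (hX.eq_bot_or_eq _ (by rintro _ ⟨x, -, rfl⟩; exact x.2) hstab).imp
    (fun h => ?_) fun h => ?_
  · rw [AddSubgroup.map_eq_bot_iff_of_injective _ Subtype.val_injective] at h
    exact Submodule.toAddSubgroup_injective h
  · refine (Submodule.eq_top_iff').2 fun x => ?_
    obtain ⟨y, hy, hyx⟩ := h.ge x.2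
    rwa [← Subtype.ext hyx]

theorem IsMinStable.hasOddDim [Finite V] (h2 : ∀ v : V, v + v = 0)
    (hc : ∀ φ ∈ Φ, ∀ ψ ∈ Ψ, Commute φ ψ) (hX : IsMinStable (Φ ∪ Ψ) X)
    (hΦ : ∀ W, IsMinStable Φ W → HasOddDim W) (hΨ : ∀ W, IsMinStable Ψ W → HasOddDim W) :
    HasOddDim X := by
  have := smulCommClass_restrictRing (X := X) hc
  have := smulCommClass_restrictRing (X := X) fun φ hφ ψ hψ => (hc ψ hψ φ hφ).symm
  have : Nontrivial X := X.nontrivial_iff_ne_bot.2 hX.ne_bot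
  refine hasOddDim_of_isJointlySimple (S := restrictRing Φ X) (restrictRing Ψ X)
    (fun v => Subtype.ext (h2 v)) hX.isJointlySimple (fun L hL => ?_) fun L hL => ?_
  · have := hΦ _ (isMinStable_map (fun φ hφ => hX.stable φ (.inl hφ)) L)
    unfold HasOddDim at this
    rwa [card_map_subtype] at this
  · have := hΨ _ (isMinStable_map (fun φ hφ => hX.stable φ (.inr hφ)) L)
    unfold HasOddDim at this
    rwa [card_map_subtype] at this

theorem IsMinStable.exists_sq_card_le [Finite V]
    (hc : ∀ φ ∈ Φ, ∀ ψ ∈ Ψ, Commute φ ψ) (hX : IsMinStable (Φ ∪ Ψ) X)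
    (hΨ : ∃ ψ ∈ Ψ, ∃ ψ' ∈ Ψ, ∃ x ∈ X, ψ (ψ' x) ≠ ψ' (ψ x)) :
    ∃ W, IsMinStable Φ W ∧ Nat.card W ^ 2 ≤ Nat.card X := by
  have := smulCommClass_restrictRing (X := X) fun φ hφ ψ hψ => (hc ψ hψ φ hφ).symm
  have : Nontrivial X := X.nontrivial_iff_ne_bot.2 hX.ne_bot
  have hXΦ : IsStable Φ X := fun φ hφ => hX.stable φ (.inl hφ)
  have hXΨ : IsStable Ψ X := fun φ hφ => hX.stable φ (.inr hφ)
  obtain ⟨L, hL⟩ := exists_isSimpleModule_submodule (S := restrictRing Φ X) (V := X)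
  refine ⟨_, isMinStable_map hXΦ L, ?_⟩
  rw [card_map_subtype]
  refine sq_card_le_of_isJointlySimple (restrictRing Ψ X) hX.isJointlySimple ?_ L
  obtain ⟨ψ, hψ, ψ', hψ', x, hx, hne⟩ := hΨ
  exact ⟨restrictEnd hXΨ ψ hψ, restrictEnd hXΨ ψ' hψ', ⟨x, hx⟩,
    fun h => hne (congrArg Subtype.val h)⟩

theorem IsMinStable.exists_card_eq_pow [Finite V]
    (hc : ∀ φ ∈ Φ, ∀ ψ ∈ Ψ, Commute φ ψ) (hX : IsMinStable (Φ ∪ Ψ) X)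
    {W W' : AddSubgroup V} (hW : IsMinStable Φ W) (hW' : IsMinStable Φ W')
    (hWX : W ≤ X) (hWX' : W' ≤ X) :
    Nat.card W' = Nat.card W ∧ ∃ m, Nat.card X = Nat.card W ^ m := by
  have := smulCommClass_restrictRing (X := X) fun φ hφ ψ hψ => (hc ψ hψ φ hφ).symm
  have hXΦ : IsStable Φ X := fun φ hφ => hX.stable φ (.inl hφ)
  have := hW.isSimpleModule hXΦ hWX
  have := hW'.isSimpleModule hXΦ hWX'
  have hJ := hX.isJointlySimple
  constructor
  · obtain ⟨e⟩ := hJ.isIsotypicOfType (stableSubmodule X W hW.stable)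
      (stableSubmodule X W' hW'.stable)
    rw [← card_stableSubmodule W hW.stable hWX, ← card_stableSubmodule W' hW'.stable hWX']
    exact Nat.card_congr e.toEquiv
  · obtain ⟨m, h, -⟩ := hJ.card_hom_eq (stableSubmodule X W hW.stable)
    exact ⟨m, by rw [h, card_stableSubmodule W hW.stable hWX]⟩

theorem IsStable.exists_isMinStable [Finite V] (hX : IsStable Φ X) (hX0 : X ≠ ⊥) :
    ∃ W ≤ X, IsMinStable Φ W := by
  have : Nontrivial X := X.nontrivial_iff_ne_bot.2 hX0
  obtain ⟨L, hL⟩ := exists_isSimpleModule_submodule (S := restrictRing Φ X) (V := X)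
  exact ⟨_, by rintro _ ⟨x, -, rfl⟩; exact x.2, isMinStable_map hX L⟩

end MinimalStable

section DirectPowers

variable {ι T V : Type*} [Group T] [AddCommGroup V] [DecidableEq ι]

/-- The endomorphisms given by group elements whose components outside `s` are trivial. -/
def supportedEnds (ρ : (ι → T) →* AddMonoid.End V) (s : Finset ι) : Set (AddMonoid.End V) :=
  {φ | ∃ g : ι → T, (∀ i ∉ s, g i = 1) ∧ ρ g = φ}

theorem mulSingle_mul_comm (i : ι) (t : T) (g : ι → T) :
    Pi.mulSingle i t * g = g * Pi.mulSingle i ((g i)⁻¹ * t * g i) := by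
  funext j
  by_cases hj : j = i
  · subst hj; simp [mul_assoc]
  · simp [hj]

variable (ρ : (ι → T) →* AddMonoid.End V)

theorem commute_supportedEnds {s t : Finset ι} (h : Disjoint s t) :
    ∀ φ ∈ supportedEnds ρ s, ∀ ψ ∈ supportedEnds ρ t, Commute φ ψ := by
  rintro _ ⟨g, hg, rfl⟩ _ ⟨g', hg', rfl⟩
  refine Commute.map (funext fun i => ?_) ρ
  by_cases hi : i ∈ s
  · simp [hg' i (Finset.disjoint_left.1 h hi)]
  · simp [hg i hi]

theorem isStable_supportedEnds_union {s t : Finset ι} {U : AddSubgroup V} :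
    IsStable (supportedEnds ρ (s ∪ t)) U ↔ IsStable (supportedEnds ρ s ∪ supportedEnds ρ t) U := by
  constructor
  · rintro h _ (⟨g, hg, rfl⟩ | ⟨g, hg, rfl⟩)
    · exact h _ ⟨g, fun i hi => hg i fun h => hi (Finset.mem_union_left _ h), rfl⟩
    · exact h _ ⟨g, fun i hi => hg i fun h => hi (Finset.mem_union_right _ h), rfl⟩
  · rintro h _ ⟨g, hg, rfl⟩ u hu
    have hmul : g = (fun i => if i ∈ s then g i else 1) * fun i => if i ∈ s then 1 else g i := by
      funext i
      by_cases hi : i ∈ s <;> simp [hi]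
    rw [hmul, map_mul]
    refine h _ (.inl ⟨_, fun i hi => by simp [hi], rfl⟩) _
      (h _ (.inr ⟨_, fun i hi => ?_, rfl⟩) _ hu)
    by_cases his : i ∈ s
    · simp [his]
    · simp [his, hg i (by simp [hi, his])]

theorem isMinStable_supportedEnds_union {s t : Finset ι} {X : AddSubgroup V}
    (h : IsMinStable (supportedEnds ρ (s ∪ t)) X) :
    IsMinStable (supportedEnds ρ s ∪ supportedEnds ρ t) X :=
  ⟨h.ne_bot, (isStable_supportedEnds_union ρ).1 h.stable,
    fun U hU hs => h.eq_bot_or_eq U hU ((isStable_supportedEnds_union ρ).2 hs)⟩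

theorem hasOddDim_of_supportedEnds [Finite V] (h2 : ∀ v : V, v + v = 0)
    (h : ∀ i W, IsMinStable (supportedEnds ρ {i}) W → HasOddDim W)
    (s : Finset ι) (hs : s.Nonempty) :
    ∀ X, IsMinStable (supportedEnds ρ s) X → HasOddDim X := by
  induction hs using Finset.Nonempty.cons_induction with
  | singleton i => exact h i
  | cons i s hi _ ih =>
    intro X hX
    rw [Finset.cons_eq_insert, Finset.insert_eq] at hX
    exact (isMinStable_supportedEnds_union ρ hX).hasOddDim h2
      (commute_supportedEnds ρ (Finset.disjoint_singleton_left.2 hi)) (h i) ih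

theorem pow_le_card_of_supportedEnds [Finite V]
    (hne : ∀ (j : ι) (v : V), v ≠ 0 →
      ∃ a b : T, ρ (Pi.mulSingle j (a * b)) v ≠ ρ (Pi.mulSingle j (b * a)) v)
    (i : ι) (w : ℕ) (hw : ∀ W, IsMinStable (supportedEnds ρ {i}) W → Nat.card W = w)
    (s : Finset ι) (his : i ∉ s) :
    ∀ X, IsMinStable (supportedEnds ρ (insert i s)) X → w ^ 2 ^ s.card ≤ Nat.card X := by
  induction s using Finset.induction_on with
  | empty =>
    intro X hX
    simp [hw X hX]
  | insert j s hj ih =>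
    intro X hX
    have hset : insert i (insert j s) = insert i s ∪ {j} := by
      ext; simp
    rw [hset] at hX
    have hdisj : Disjoint (insert i s) {j} := by
      simp only [Finset.disjoint_singleton_right, Finset.mem_insert, not_or]
      exact ⟨fun h => his (by simp [h]), hj⟩
    obtain ⟨x, hxX, hx⟩ := X.bot_or_exists_ne_zero.resolve_left hX.ne_bot
    obtain ⟨a, b, hab⟩ := hne j x hx
    have hmem : ∀ a : T, ρ (Pi.mulSingle j a) ∈ supportedEnds ρ {j} := fun a =>
      ⟨_, fun i hi => by simp [Finset.notMem_singleton.1 hi], rfl⟩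
    obtain ⟨W, hW, hcard⟩ := (isMinStable_supportedEnds_union ρ hX).exists_sq_card_le
      (commute_supportedEnds ρ hdisj)
      ⟨_, hmem a, _, hmem b, x, hxX, by
        simp only [Pi.mulSingle_mul, map_mul] at hab
        exact hab⟩
    have := ih (fun h => his (Finset.mem_insert_of_mem h)) W hW
    rw [Finset.card_insert_of_notMem hj, pow_succ, pow_mul]
    exact (Nat.pow_le_pow_left this 2).trans hcard

variable [Fintype ι]

omit [DecidableEq ι] in
theorem isStable_supportedEnds_univ {U : AddSubgroup V} :
    IsStable (supportedEnds ρ Finset.univ) U ↔ ∀ g, ∀ u ∈ U, ρ g u ∈ U :=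
  ⟨fun h g => h _ ⟨g, by simp, rfl⟩, by rintro h _ ⟨g, -, rfl⟩; exact h g⟩

omit [Fintype ι] in
theorem isStable_supportedEnds_singleton {i : ι} {U : AddSubgroup V} :
    IsStable (supportedEnds ρ {i}) U ↔ ∀ t, ∀ u ∈ U, ρ (Pi.mulSingle i t) u ∈ U := by
  refine ⟨fun h t => h _ ⟨_, fun j hj => by simp [Finset.notMem_singleton.1 hj], rfl⟩, ?_⟩
  rintro h _ ⟨g, hg, rfl⟩
  have : g = Pi.mulSingle i (g i) := by
    funext j
    by_cases hj : j = i
    · subst hj; simp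
    · rw [Pi.mulSingle_eq_of_ne hj, hg j (by simpa using hj)]
  rw [this]
  exact h _

theorem IsMinStable.card_eq_pow_of_supportedEnds [Finite V] {X : AddSubgroup V}
    (hX : IsMinStable (supportedEnds ρ Finset.univ) X) {i : ι} {W W' : AddSubgroup V}
    (hW : IsMinStable (supportedEnds ρ {i}) W) (hW' : IsMinStable (supportedEnds ρ {i}) W')
    (hWX : W ≤ X) (hWX' : W' ≤ X) :
    Nat.card W' = Nat.card W ∧ ∃ m, Nat.card X = Nat.card W ^ m := by
  rw [← Finset.insert_erase (Finset.mem_univ i), Finset.insert_eq] at hX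
  exact (isMinStable_supportedEnds_union ρ hX).exists_card_eq_pow
    (commute_supportedEnds ρ (by simp)) hW hW' hWX hWX'

theorem exists_mulSingle_mul_ne (hX : IsMinStable (supportedEnds ρ Finset.univ) ⊤)
    (hρ : Function.Injective ρ) (hT : ∃ a b : T, a * b ≠ b * a) (j : ι) (v : V) (hv : v ≠ 0) :
    ∃ a b : T, ρ (Pi.mulSingle j (a * b)) v ≠ ρ (Pi.mulSingle j (b * a)) v := by
  by_contra! hall
  let U : AddSubgroup V :=
    { carrier := {v | ∀ a b : T, ρ (Pi.mulSingle j (a * b)) v = ρ (Pi.mulSingle j (b * a)) v}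
      zero_mem' := fun a b => by simp
      add_mem' := fun hx hy a b => by rw [map_add, map_add, hx, hy]
      neg_mem' := fun hx a b => by rw [map_neg, map_neg, hx] }
  have hU : U = ⊤ := by
    refine (hX.eq_bot_or_eq U le_top
      ((isStable_supportedEnds_univ ρ).2 fun g u hu a b => ?_)).resolve_left ?_
    · have key : ∀ t, ρ (Pi.mulSingle j t) (ρ g u) =
          ρ g (ρ (Pi.mulSingle j ((g j)⁻¹ * t * g j)) u) :=
        fun t => DFunLike.congr_fun
          ((map_mul ρ _ _).symm.trans
            ((congrArg ρ (mulSingle_mul_comm j t g)).trans (map_mul ρ _ _))) u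
      rw [key, key]
      have := hu ((g j)⁻¹ * a * g j) ((g j)⁻¹ * b * g j)
      simp only [mul_assoc, mul_inv_cancel_left] at this ⊢
      rw [this]
    · intro hbot
      exact hv ((AddSubgroup.eq_bot_iff_forall U).1 hbot v hall)
  obtain ⟨a, b, hab⟩ := hT
  refine hab (Pi.mulSingle_injective j (hρ (DFunLike.ext _ _ fun v => ?_)))
  have : v ∈ U := hU ▸ AddSubgroup.mem_top v
  exact this a b

end DirectPowers

section Realization

open Matrix

/-- There is a faithful irreducible homomorphism from `G` to `GL_{2n}(2)`. -/
def HasFaithfulIrreducible (G : Type*) [Group G] (n : ℕ) : Prop :=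
  ∃ ρ : G →* GL (Fin (2 * n)) (ZMod 2), Function.Injective ρ ∧
    ∀ W : Submodule (ZMod 2) (Fin (2 * n) → ZMod 2),
      (∀ g : G, ∀ v ∈ W,
        Matrix.mulVec ((ρ g : Matrix (Fin (2 * n)) (Fin (2 * n)) (ZMod 2))) v ∈ W) →
      W = ⊥ ∨ W = ⊤

theorem hasFaithfulIrreducible_of_isMinStable {G V : Type*} [Group G] [AddCommGroup V] [Finite V]
    (h2 : ∀ v : V, v + v = 0) (σ : G →* AddMonoid.End V) (W : AddSubgroup V)
    (hstab : ∀ g, ∀ w ∈ W, σ g w ∈ W)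
    (hmin : ∀ U ≤ W, (∀ g, ∀ u ∈ U, σ g u ∈ U) → U = ⊥ ∨ U = W)
    (hfaith : ∀ g, (∀ w ∈ W, σ g w = w) → g = 1) (n : ℕ) (hn : Nat.card W = 2 ^ (2 * n)) :
    HasFaithfulIrreducible G n := by
  let _ : Module (ZMod 2) W := AddCommGroup.zmodModule (n := 2) fun w => by
    rw [two_nsmul]; exact Subtype.ext (h2 w)
  have hrank : Module.finrank (ZMod 2) W = 2 * n := by
    rw [Module.natCard_eq_pow_finrank (K := ZMod 2), Nat.card_zmod] at hn
    exact Nat.pow_right_injective le_rfl hn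
  let b := Module.finBasisOfFinrankEq (ZMod 2) W hrank
  let τ : G →* Module.End (ZMod 2) W :=
    { toFun := fun g => AddMonoidHom.toZModLinearMap 2
        (AddMonoidHom.codRestrict (AddMonoidHom.comp (σ g) W.subtype) W fun x => hstab g x x.2)
      map_one' := LinearMap.ext fun w => Subtype.ext (by
        change σ 1 w = w
        rw [map_one]; rfl)
      map_mul' := fun g h => LinearMap.ext fun w => Subtype.ext (by
        change σ (g * h) w = σ g (σ h w)
        rw [map_mul]; rfl) }
  have hτ : ∀ g w, (τ g w : V) = σ g w := fun _ _ => rfl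
  let m : Module.End (ZMod 2) W →* Matrix (Fin (2 * n)) (Fin (2 * n)) (ZMod 2) :=
    (LinearMap.toMatrixAlgEquiv b : _ →* _)
  have hm : ∀ f w, m f *ᵥ b.repr w = b.repr (f w) := fun f w =>
    LinearMap.toMatrix_mulVec_repr b b f w
  refine ⟨(m.comp τ).toHomUnits, ?_, fun U hU => ?_⟩
  · refine (injective_iff_map_eq_one _).2 fun g hg => hfaith g fun w hw => ?_
    have h1 : m (τ g) = 1 := congrArg Units.val hg
    have h3 := hm (τ g) ⟨w, hw⟩
    rw [h1, one_mulVec] at h3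
    have h4 := b.repr.injective (DFunLike.coe_injective h3)
    rw [← hτ g ⟨w, hw⟩, ← h4]
  · let e : W ≃ₗ[ZMod 2] (Fin (2 * n) → ZMod 2) := b.equivFun
    have he : ∀ g w, m (τ g) *ᵥ e w = e (τ g w) := fun g w => hm (τ g) w
    let U' : AddSubgroup V := (U.comap e.toLinearMap).toAddSubgroup.map W.subtype
    have hU' : U' ≤ W := by rintro _ ⟨x, -, rfl⟩; exact x.2
    refine (hmin U' hU' ?_).imp (fun h => ?_) fun h => ?_
    · rintro g _ ⟨w, hw, rfl⟩
      refine ⟨τ g w, ?_, rfl⟩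
      change e (τ g w) ∈ U
      rw [← he]
      exact hU g _ hw
    · refine (Submodule.eq_bot_iff U).2 fun u hu => ?_
      have : ((e.symm u : W) : V) ∈ U' := ⟨e.symm u, by simpa using hu, rfl⟩
      rw [h, AddSubgroup.mem_bot] at this
      exact e.symm.map_eq_zero_iff.1 (Subtype.ext this)
    · refine (Submodule.eq_top_iff').2 fun u => ?_
      obtain ⟨w, hw, hwu⟩ := h.ge (e.symm u).2
      rw [Subtype.ext hwu] at hw
      simpa using hw

end Realization

section OuterPower

open Matrix

variable {ι T : Type*} [Fintype ι] [DecidableEq ι] [Group T] {d : ℕ}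

/-- The `ι`-fold Kronecker power of a matrix representation. -/
def kroneckerPower (r : T →* GL (Fin d) (ZMod 2)) :
    (ι → T) →* Matrix (ι → Fin d) (ι → Fin d) (ZMod 2) where
  toFun g := Matrix.of fun x z => ∏ i, (r (g i) : Matrix (Fin d) (Fin d) (ZMod 2)) (x i) (z i)
  map_one' := by
    ext x z
    by_cases h : x = z
    · subst h; simp
    · obtain ⟨i, hi⟩ := Function.ne_iff.1 h
      rw [Matrix.one_apply_ne h]
      exact Finset.prod_eq_zero (Finset.mem_univ i) (by simp [Matrix.one_apply_ne hi])
  map_mul' g h := by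
    ext x z
    simp only [Pi.mul_apply, map_mul, Units.val_mul, Matrix.mul_apply, Matrix.of_apply,
      ← Finset.prod_mul_distrib]
    rw [Finset.prod_univ_sum, Fintype.piFinset_univ]

/-- The action of a direct power on functions of several variables by Kronecker powers. -/
def kroneckerRep (r : T →* GL (Fin d) (ZMod 2)) :
    (ι → T) →* AddMonoid.End ((ι → Fin d) → ZMod 2) where
  toFun g := (Matrix.mulVecLin (kroneckerPower r g)).toAddMonoidHom
  map_one' := DFunLike.ext _ _ fun F => by
    change kroneckerPower r 1 *ᵥ F = F
    rw [map_one, one_mulVec]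
  map_mul' g h := DFunLike.ext _ _ fun F => by
    change kroneckerPower r (g * h) *ᵥ F = kroneckerPower r g *ᵥ (kroneckerPower r h *ᵥ F)
    rw [map_mul, mulVec_mulVec]

/-- Restriction of a function of several variables to the line through `x` in direction `i`. -/
def slice (i : ι) (x : ι → Fin d) : ((ι → Fin d) → ZMod 2) →+ (Fin d → ZMod 2) where
  toFun F y := F (Function.update x i y)
  map_zero' := rfl
  map_add' _ _ := rfl

theorem slice_kroneckerRep_mulSingle (r : T →* GL (Fin d) (ZMod 2)) (i : ι) (x : ι → Fin d)
    (t : T) (F : (ι → Fin d) → ZMod 2) :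
    slice i x (kroneckerRep r (Pi.mulSingle i t) F) =
      (r t : Matrix (Fin d) (Fin d) (ZMod 2)) *ᵥ slice i x F := by
  funext y
  change ∑ z, (∏ j, (r (Pi.mulSingle (M := fun _ => T) i t j) : Matrix (Fin d) (Fin d) (ZMod 2))
    (Function.update x i y j) (z j)) * F z = ∑ y', _ * F (Function.update x i y')
  symm
  refine Finset.sum_of_injOn (fun y' => Function.update x i y')
    (Function.update_injective x i).injOn (fun _ _ => Finset.mem_coe.2 (Finset.mem_univ _))
    (fun z _ hz => ?_) fun y' _ => ?_
  · have hne : z ≠ Function.update x i (z i) := fun h =>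
      hz ⟨z i, Finset.mem_coe.2 (Finset.mem_univ _), h.symm⟩
    obtain ⟨j, hj⟩ := Function.ne_iff.1 hne
    have hji : j ≠ i := by rintro rfl; simp at hj
    rw [Function.update_of_ne hji] at hj
    rw [Finset.prod_eq_zero (Finset.mem_univ j), zero_mul]
    simp [hji, Matrix.one_apply_ne hj.symm]
  · congr 1
    rw [Finset.prod_eq_single i]
    · simp
    · intro j _ hj
      simp [hj]
    · simp

/-- Every nonzero subgroup stable under an irreducible group of matrices is everything. -/
theorem addSubgroup_eq_bot_or_eq_top {G : Type*} [Group G] (r : G →* GL (Fin d) (ZMod 2))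
    (hr : ∀ W : Submodule (ZMod 2) (Fin d → ZMod 2),
      (∀ g : G, ∀ v ∈ W, (r g : Matrix (Fin d) (Fin d) (ZMod 2)) *ᵥ v ∈ W) → W = ⊥ ∨ W = ⊤)
    (U : AddSubgroup (Fin d → ZMod 2))
    (hU : ∀ g : G, ∀ v ∈ U, (r g : Matrix (Fin d) (Fin d) (ZMod 2)) *ᵥ v ∈ U) :
    U = ⊥ ∨ U = ⊤ := by
  refine (hr (AddSubgroup.toZModSubmodule 2 U) hU).imp (fun h => ?_) fun h => ?_
  · exact (map_eq_bot_iff (AddSubgroup.toZModSubmodule 2)).1 h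
  · exact (map_eq_top_iff (AddSubgroup.toZModSubmodule 2)).1 h

theorem exists_bijective_slice (r : T →* GL (Fin d) (ZMod 2))
    (hr : ∀ W : Submodule (ZMod 2) (Fin d → ZMod 2),
      (∀ g : T, ∀ v ∈ W, (r g : Matrix (Fin d) (Fin d) (ZMod 2)) *ᵥ v ∈ W) → W = ⊥ ∨ W = ⊤)
    (i : ι) {L : AddSubgroup ((ι → Fin d) → ZMod 2)}
    (hL : IsMinStable (supportedEnds (kroneckerRep r) {i}) L) :
    ∃ x, Function.Bijective ((slice i x).comp L.subtype) := by
  have hstab := (isStable_supportedEnds_singleton _).1 hL.stable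
  obtain ⟨F, hFL, hF⟩ := L.bot_or_exists_ne_zero.resolve_left hL.ne_bot
  obtain ⟨x, hx⟩ := Function.ne_iff.1 hF
  have hsF : slice i x F ≠ 0 := fun h => hx (by
    have := congrFun h (x i)
    simpa [slice] using this)
  refine ⟨x, ?_, ?_⟩
  · refine (injective_iff_map_eq_zero _).2 fun F' hF' => ?_
    have hbot : L ⊓ (slice i x).ker = ⊥ := by
      refine (hL.eq_bot_or_eq _ inf_le_left
        ((isStable_supportedEnds_singleton _).2 fun t u hu => ⟨hstab t u hu.1, ?_⟩)).resolve_right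
        fun h => hsF (AddMonoidHom.mem_ker.1 (h.ge hFL).2)
      have hu := AddMonoidHom.mem_ker.1 hu.2
      exact AddMonoidHom.mem_ker.2 (by rw [slice_kroneckerRep_mulSingle, hu, mulVec_zero])
    exact Subtype.ext ((AddSubgroup.mem_bot).1 (hbot.le ⟨F'.2, AddMonoidHom.mem_ker.2 hF'⟩))
  · rw [← AddMonoidHom.range_eq_top]
    refine (addSubgroup_eq_bot_or_eq_top r hr _ ?_).resolve_left fun h => hsF ?_
    · rintro t _ ⟨u, rfl⟩
      exact ⟨⟨_, hstab t u u.2⟩, slice_kroneckerRep_mulSingle r i x t u⟩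
    · exact (AddSubgroup.mem_bot).1 (h.le ⟨⟨F, hFL⟩, rfl⟩)

theorem exists_conj_ne [IsSimpleGroup T] (hT : ∃ a b : T, a * b ≠ b * a) {a : T} (ha : a ≠ 1) :
    ∃ t, t * a ≠ a * t := by
  by_contra! h
  have hmem : a ∈ Subgroup.center T := Subgroup.mem_center_iff.2 h
  rcases (inferInstance : (Subgroup.center T).Normal).eq_bot_or_eq_top with hc | hc
  · rw [hc] at hmem
    exact ha (Subgroup.mem_bot.1 hmem)
  · obtain ⟨x, y, hxy⟩ := hT
    exact hxy (Subgroup.mem_center_iff.1 (hc ▸ Subgroup.mem_top y) x)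

theorem HasFaithfulIrreducible.exists_pi [IsSimpleGroup T] (hT : ∃ a b : T, a * b ≠ b * a)
    [Nonempty ι] {n : ℕ} (h : HasFaithfulIrreducible T n) :
    ∃ N, HasFaithfulIrreducible (ι → T) N := by
  obtain ⟨r, hinj, hr⟩ := h
  let ρ : (ι → T) →* AddMonoid.End ((ι → Fin (2 * n)) → ZMod 2) := kroneckerRep r
  have h2 : ∀ v : (ι → Fin (2 * n)) → ZMod 2, v + v = 0 := fun v =>
    funext fun x => CharTwo.add_self_eq_zero (v x)
  have hn : n ≠ 0 := by
    rintro rfl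
    obtain ⟨a, b, hab⟩ := hT
    exact hab (hinj (Units.ext (by ext i; exact i.elim0)))
  have : NeZero (2 * n) := ⟨by omega⟩
  obtain ⟨X, -, hX⟩ := IsStable.exists_isMinStable (Φ := supportedEnds ρ Finset.univ) (X := ⊤)
    (fun _ _ _ _ => AddSubgroup.mem_top _) top_ne_bot
  have hXs := (isStable_supportedEnds_univ ρ).1 hX.stable
  have hL : ∀ i, ∃ L ≤ X, IsMinStable (supportedEnds ρ {i}) L := fun i =>
    IsStable.exists_isMinStable ((isStable_supportedEnds_singleton ρ).2 fun t => hXs _) hX.ne_bot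
  let i₀ := Classical.arbitrary ι
  obtain ⟨L, hLX, hL₀⟩ := hL i₀
  obtain ⟨x, hx⟩ := exists_bijective_slice r hr i₀ hL₀
  have hcard : Nat.card L = 2 ^ (2 * n) := by
    rw [Nat.card_congr (Equiv.ofBijective _ hx)]
    simp
  obtain ⟨-, m, hm⟩ := hX.card_eq_pow_of_supportedEnds ρ hL₀ hL₀ hLX hLX
  refine ⟨n * m, hasFaithfulIrreducible_of_isMinStable h2 ρ X hXs
    (fun U hUX hU => hX.eq_bot_or_eq U hUX ((isStable_supportedEnds_univ ρ).2 hU))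
    (fun g hg => ?_) (n * m) (by rw [hm, hcard, ← pow_mul, mul_assoc])⟩
  by_contra hg1
  obtain ⟨i, hi⟩ := Function.ne_iff.1 hg1
  obtain ⟨t, ht⟩ := exists_conj_ne hT hi
  obtain ⟨L', hLX', hL'⟩ := hL i
  obtain ⟨x', hx'⟩ := exists_bijective_slice r hr i hL'
  have hact : ∀ u ∈ X, ρ (Pi.mulSingle i t) u = ρ (Pi.mulSingle i ((g i)⁻¹ * t * g i)) u := by
    intro u hu
    have e := DFunLike.congr_fun (congrArg ρ (mulSingle_mul_comm i t g)) u
    simp only [map_mul] at e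
    change ρ _ (ρ g u) = ρ g (ρ _ u) at e
    simpa only [hg u hu, hg _ (hXs _ u hu), ← map_mul] using e
  refine ht (eq_inv_mul_iff_mul_eq.1 (Eq.trans ?_ (mul_assoc _ _ _))).symm
  refine hinj (Units.ext (Matrix.mulVec_injective ?_))
  funext v
  obtain ⟨u, rfl⟩ := hx'.2 v
  have := congrArg (slice i x') (hact u (hLX' u.2))
  rwa [slice_kroneckerRep_mulSingle, slice_kroneckerRep_mulSingle] at this

end OuterPower

section MainBound

open Matrix

/-- The action by additive endomorphisms underlying a matrix representation. -/
def mulVecRep {G : Type*} [Group G] {d : ℕ} (r : G →* GL (Fin d) (ZMod 2)) :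
    G →* AddMonoid.End (Fin d → ZMod 2) where
  toFun g := (Matrix.mulVecLin (r g : Matrix (Fin d) (Fin d) (ZMod 2))).toAddMonoidHom
  map_one' := DFunLike.ext _ _ fun F => by
    change (r 1).val *ᵥ F = F
    rw [map_one, Units.val_one, one_mulVec]
  map_mul' g h := DFunLike.ext _ _ fun F => by
    change (r (g * h)).val *ᵥ F = (r g).val *ᵥ ((r h).val *ᵥ F)
    rw [map_mul, Units.val_mul, mulVec_mulVec]

theorem mulVecRep_injective {G : Type*} [Group G] {d : ℕ} {r : G →* GL (Fin d) (ZMod 2)}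
    (hr : Function.Injective r) : Function.Injective (mulVecRep r) := fun _ _ hgh =>
  hr (Units.ext (Matrix.mulVec_injective (funext fun v => DFunLike.congr_fun hgh v)))

theorem HasFaithfulIrreducible.exists_le_of_pi {ι T : Type*} [Fintype ι] [DecidableEq ι]
    [Nonempty ι] [Group T] [IsSimpleGroup T] (hT : ∃ a b : T, a * b ≠ b * a) {N : ℕ}
    (h : HasFaithfulIrreducible (ι → T) N) :
    ∃ n, HasFaithfulIrreducible T n ∧ n * 2 ^ (Fintype.card ι - 1) ≤ N := by
  obtain ⟨r, hinj, hr⟩ := h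
  let ρ := mulVecRep r
  have hρ : Function.Injective ρ := mulVecRep_injective hinj
  have h2 : ∀ v : Fin (2 * N) → ZMod 2, v + v = 0 := fun v =>
    funext fun x => CharTwo.add_self_eq_zero (v x)
  have hcardV : Nat.card (⊤ : AddSubgroup (Fin (2 * N) → ZMod 2)) = 2 ^ (2 * N) := by
    rw [AddSubgroup.card_top]; simp
  have hN : N ≠ 0 := by
    rintro rfl
    have : Subsingleton (GL (Fin (2 * 0)) (ZMod 2)) :=
      ⟨fun a b => Units.ext (by ext i; exact i.elim0)⟩
    obtain ⟨a, b, hab⟩ := hT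
    have i := Classical.arbitrary ι
    exact hab (Pi.mulSingle_injective i (hinj (Subsingleton.elim _ _)))
  have : NeZero (2 * N) := ⟨by omega⟩
  have hV : IsMinStable (supportedEnds ρ Finset.univ) ⊤ :=
    ⟨top_ne_bot, fun _ _ _ _ => AddSubgroup.mem_top _, fun U _ hU =>
      addSubgroup_eq_bot_or_eq_top r hr U ((isStable_supportedEnds_univ ρ).1 hU)⟩
  have hne := exists_mulSingle_mul_ne ρ hV hρ hT
  obtain ⟨i, W, hW, hodd⟩ : ∃ i W, IsMinStable (supportedEnds ρ {i}) W ∧ ¬ HasOddDim W := by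
    by_contra! hall
    obtain ⟨c, hc, hc'⟩ := hasOddDim_of_supportedEnds ρ h2 hall _ Finset.univ_nonempty ⊤ hV
    rw [hcardV] at hc'
    have := Nat.pow_right_injective le_rfl hc'
    rw [← this] at hc
    exact Nat.not_odd_iff_even.2 (even_two_mul N) hc
  obtain ⟨n, hn⟩ : ∃ n, Nat.card W = 2 ^ (2 * n) := by
    have := Module.natCard_eq_pow_finrank (K := ZMod 2) (V := AddSubgroup.toZModSubmodule 2 W)
    rw [Nat.card_zmod] at this
    rcases Nat.even_or_odd (Module.finrank (ZMod 2) (AddSubgroup.toZModSubmodule 2 W)) with he | ho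
    · obtain ⟨n, hn⟩ := he.two_dvd
      exact ⟨n, hn ▸ this⟩
    · exact absurd ⟨_, ho, this⟩ hodd
  have hstab := (isStable_supportedEnds_singleton ρ).1 hW.stable
  refine ⟨n, hasFaithfulIrreducible_of_isMinStable h2 (ρ.comp (MonoidHom.mulSingle _ i)) W hstab
    (fun U hUW hU => hW.eq_bot_or_eq U hUW ((isStable_supportedEnds_singleton ρ).2 hU))
    (fun g hg => ?_) n hn, ?_⟩
  · let K : Subgroup T :=
      { carrier := {t | ∀ w ∈ W, ρ (Pi.mulSingle i t) w = w}
        one_mem' := fun w _ => by rw [Pi.mulSingle_one, map_one]; rfl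
        mul_mem' := fun {a b} ha hb w hw => by
          rw [Pi.mulSingle_mul, map_mul]
          exact (congrArg _ (hb w hw)).trans (ha w hw)
        inv_mem' := fun {a} ha w hw => by
          have h1 : (ρ (Pi.mulSingle i a⁻¹) * ρ (Pi.mulSingle i a)) w = w := by
            rw [← map_mul, ← Pi.mulSingle_mul, inv_mul_cancel, Pi.mulSingle_one, map_one]; rfl
          exact (congrArg _ (ha w hw)).symm.trans h1 }
    have hK : K.Normal := ⟨fun a ha t w hw => by
      have h1 : (ρ (Pi.mulSingle i t) * ρ (Pi.mulSingle i t⁻¹)) w = w := by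
        rw [← map_mul, ← Pi.mulSingle_mul, mul_inv_cancel, Pi.mulSingle_one, map_one]; rfl
      rw [Pi.mulSingle_mul, Pi.mulSingle_mul, map_mul, map_mul]
      exact (congrArg (ρ _) (ha _ (hstab t⁻¹ w hw))).trans h1⟩
    rcases hK.eq_bot_or_eq_top with hbot | htop
    · exact Subgroup.mem_bot.1 (hbot.le hg)
    · obtain ⟨w, hwW, hw⟩ := W.bot_or_exists_ne_zero.resolve_left hW.ne_bot
      obtain ⟨a, b, hab⟩ := hne i w hw
      have hall : ∀ t, ρ (Pi.mulSingle i t) w = w := fun t => (htop.ge (Subgroup.mem_top t)) w hwW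
      exact absurd ((hall _).trans (hall _).symm) hab
  · have hcard : ∀ W', IsMinStable (supportedEnds ρ {i}) W' → Nat.card W' = 2 ^ (2 * n) :=
      fun W' hW' => hn ▸ (hV.card_eq_pow_of_supportedEnds ρ hW hW' le_top le_top).1
    have := pow_le_card_of_supportedEnds ρ hne i _ hcard (Finset.univ.erase i)
      (Finset.notMem_erase i _) ⊤ (by rwa [Finset.insert_erase (Finset.mem_univ i)])
    rw [hcardV, ← pow_mul, Finset.card_erase_of_mem (Finset.mem_univ i), Finset.card_univ,
      Nat.pow_le_pow_iff_right one_lt_two] at this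
    linarith

end MainBound

/-- For a finite nonabelian simple group `T`, `ℓ ≥ 1`, and `G = T^ℓ`,
one has `n'_G ≥ n'_T · 2^{ℓ-1}`. -/
theorem stmt_16 {T : Type*} [Group T] [Finite T]
    (hT : IsSimpleGroup T) (hTna : ∃ a b : T, a * b ≠ b * a)
    (ℓ : ℕ) (hℓ : 1 ≤ ℓ) :
    nPrime T * 2 ^ (ℓ - 1) ≤ nPrime (Fin ℓ → T) := by
  have : NeZero ℓ := ⟨by omega⟩
  rcases {n | HasFaithfulIrreducible T n}.eq_empty_or_nonempty with h | ⟨n, hn⟩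
  · have : nPrime T = 0 := (congrArg sInf h).trans Nat.sInf_empty
    simp [this]
  · have hmem : HasFaithfulIrreducible (Fin ℓ → T) (nPrime (Fin ℓ → T)) :=
      Nat.sInf_mem (HasFaithfulIrreducible.exists_pi (ι := Fin ℓ) hTna hn)
    obtain ⟨k, hk, hle⟩ := hmem.exists_le_of_pi hTna
    rw [Fintype.card_fin] at hle
    exact (Nat.mul_le_mul_right _ (Nat.sInf_le hk)).trans hle
end
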